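/- arXiv:1304.2415 — 3 statements merged into one kernel-verified Lean document; each statement's English description precedes it below -/
import Mathlib

section
/- Let D ⊂ ℝ² be a bounded open strictly convex set with smooth boundary, let φ : ∂D → ℝ be continuous, let f : ℝ² → ℝ satisfy condition (FA), and let d ∈ ℝ. Suppose u₁ and u₂ are smooth locally convex functions on ℝ² ∖ D̄, continuous up to ∂D, each satisfying det(D²uᵢ) = f on ℝ² ∖ D̄ and uᵢ = φ on ∂D, and suppose that uᵢ(x) − ½|x|² − d·log|x| is bounded on ℝ² ∖ D̄ for i = 1, 2 (with the same constant d). Then u₁ ≡ u₂ on ℝ² ∖ D̄. -/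
open Filter Bornology Matrix MeasureTheory
open scoped RealInnerProductSpace

noncomputable section

/-- `ℝⁿ` as a Euclidean space. -/
abbrev En (n : ℕ) := EuclideanSpace ℝ (Fin n)

/-- The Hessian matrix `D²u(x)` of `u : ℝⁿ → ℝ` at `x`. -/
def Hess {n : ℕ} (u : En n → ℝ) (x : En n) : Matrix (Fin n) (Fin n) ℝ :=
  Matrix.of fun i j =>
    iteratedFDeriv ℝ 2 u x ![EuclideanSpace.single i 1, EuclideanSpace.single j 1]

/-- Condition (FA): `f` is smooth, `0 < inf f ≤ sup f < ∞`, and for every `k ≤ 3`,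
`limsup_{|x|→∞} |x|^{β+k} |Dᵏ(f-1)(x)| < ∞` (encoded as eventual boundedness near infinity). -/
def FA (n : ℕ) (f : En n → ℝ) (β : ℝ) : Prop :=
  ContDiff ℝ (⊤ : ℕ∞) f ∧
  (∃ m M : ℝ, 0 < m ∧ ∀ x, m ≤ f x ∧ f x ≤ M) ∧
  ∀ k : ℕ, k ≤ 3 → ∃ C : ℝ, ∀ᶠ x in cobounded (En n),
      ‖x‖ ^ (β + (k : ℝ)) * ‖iteratedFDeriv ℝ k (fun y => f y - 1) x‖ ≤ C

/-- `D` has smooth boundary: it admits a smooth defining function. -/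
def SmoothBoundary {n : ℕ} (D : Set (En n)) : Prop :=
  ∃ ρ : En n → ℝ, ContDiff ℝ (⊤ : ℕ∞) ρ ∧ D = {x | ρ x < 0} ∧ ∀ x ∈ frontier D, fderiv ℝ ρ x ≠ 0

/-- `u` solves the exterior problem of Lemma 3.2: continuous up to `∂D`, smooth locally convex
solution of `det D²u = f` outside `D̄`, equal to `φ` on `∂D`, with
`u - |x|²/2 - d log|x|` bounded. -/
def ExtU (D : Set (En 2)) (f φ : En 2 → ℝ) (d : ℝ) (u : En 2 → ℝ) : Prop :=
  ContinuousOn u Dᶜ ∧ ContDiffOn ℝ (⊤ : ℕ∞) u (closure D)ᶜ ∧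
  (∀ x ∈ (closure D)ᶜ, (Hess u x).PosSemidef ∧ (Hess u x).det = f x) ∧
  (∀ x ∈ frontier D, u x = φ x) ∧
  ∃ M : ℝ, ∀ x ∈ (closure D)ᶜ, |u x - ‖x‖ ^ 2 / 2 - d * Real.log ‖x‖| ≤ M

/-- The partial derivative `∂ᵢ u` of a function on the plane. -/
def pd (i : Fin 2) (u : En 2 → ℝ) : En 2 → ℝ :=
  fun x => fderiv ℝ u x (EuclideanSpace.single i 1)

section PartialDerivatives

variable {Ω : Set (En 2)} {u v : En 2 → ℝ} {x : En 2}

theorem pd_add (i : Fin 2) (hu : DifferentiableAt ℝ u x) (hv : DifferentiableAt ℝ v x) :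
    pd i (fun y => u y + v y) x = pd i u x + pd i v x := by
  simp [pd, fderiv_fun_add hu hv]

theorem pd_sub (i : Fin 2) (hu : DifferentiableAt ℝ u x) (hv : DifferentiableAt ℝ v x) :
    pd i (fun y => u y - v y) x = pd i u x - pd i v x := by
  simp [pd, fderiv_fun_sub hu hv]

theorem pd_mul (i : Fin 2) (hu : DifferentiableAt ℝ u x) (hv : DifferentiableAt ℝ v x) :
    pd i (fun y => u y * v y) x = u x * pd i v x + v x * pd i u x := by
  simp [pd, fderiv_fun_mul hu hv]

theorem pd_comp (i : Fin 2) {G : ℝ → ℝ} {G' : ℝ} (hu : DifferentiableAt ℝ u x)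
    (hG : HasDerivAt G G' (u x)) : pd i (fun y => G (u y)) x = G' * pd i u x := by
  have h := (hG.comp_hasFDerivAt x hu.hasFDerivAt).fderiv
  have h' : fderiv ℝ (fun y => G (u y)) x = G' • fderiv ℝ u x := h
  simp [pd, h']

theorem pd_congr (i : Fin 2) (hΩ : IsOpen Ω) (h : Set.EqOn u v Ω) :
    Set.EqOn (pd i u) (pd i v) Ω := by
  intro x hx
  have : u =ᶠ[nhds x] v := h.eventuallyEq_of_mem (hΩ.mem_nhds hx)
  simp [pd, this.fderiv_eq]

theorem ContDiffOn.pd {m n : WithTop ℕ∞} (hu : ContDiffOn ℝ n u Ω) (hΩ : IsOpen Ω)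
    (hmn : m + 1 ≤ n) (i : Fin 2) : ContDiffOn ℝ m (_root_.pd i u) Ω :=
  (hu.fderiv_of_isOpen hΩ hmn).clm_apply contDiffOn_const

theorem ContDiff.pd {m n : WithTop ℕ∞} (hu : ContDiff ℝ n u) (hmn : m + 1 ≤ n) (i : Fin 2) :
    ContDiff ℝ m (_root_.pd i u) :=
  (hu.fderiv_right hmn).clm_apply contDiff_const

theorem ContDiffOn.smooth_pd (hu : ContDiffOn ℝ (⊤ : ℕ∞) u Ω) (hΩ : IsOpen Ω) (i : Fin 2) :
    ContDiffOn ℝ (⊤ : ℕ∞) (_root_.pd i u) Ω :=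
  hu.pd hΩ (by simp) i

theorem ContDiff.smooth_pd (hu : ContDiff ℝ (⊤ : ℕ∞) u) (i : Fin 2) :
    ContDiff ℝ (⊤ : ℕ∞) (_root_.pd i u) :=
  hu.pd (by simp) i

theorem ContDiffOn.differentiableAt_of_isOpen (hu : ContDiffOn ℝ (⊤ : ℕ∞) u Ω) (hΩ : IsOpen Ω)
    (hx : x ∈ Ω) : DifferentiableAt ℝ u x :=
  (hu.contDiffAt (hΩ.mem_nhds hx)).differentiableAt (by simp)

theorem pd_pd_eq (i j : Fin 2) (hu : ContDiffOn ℝ (⊤ : ℕ∞) u Ω) (hΩ : IsOpen Ω) (hx : x ∈ Ω) :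
    pd i (pd j u) x
      = fderiv ℝ (fderiv ℝ u) x (EuclideanSpace.single i 1) (EuclideanSpace.single j 1) := by
  have h : DifferentiableAt ℝ (fderiv ℝ u) x :=
    ((hu.fderiv_of_isOpen (m := 1) hΩ (WithTop.coe_le_coe.2 le_top)).contDiffAt
      (hΩ.mem_nhds hx)).differentiableAt (by simp)
  have h2 := h.hasFDerivAt.clm_apply
    (hasFDerivAt_const (EuclideanSpace.single j (1 : ℝ) : En 2) x)
  have h3 : fderiv ℝ (pd j u) x = _ := h2.fderiv
  simp [pd, h3]

theorem pd_comm (i j : Fin 2) (hu : ContDiffOn ℝ (⊤ : ℕ∞) u Ω) (hΩ : IsOpen Ω) :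
    Set.EqOn (pd i (pd j u)) (pd j (pd i u)) Ω := by
  intro x hx
  rw [pd_pd_eq i j hu hΩ hx, pd_pd_eq j i hu hΩ hx]
  exact ((hu.contDiffAt (hΩ.mem_nhds hx)).isSymmSndFDerivAt
    (by simp only [minSmoothness_of_isRCLikeNormedField]; exact WithTop.coe_le_coe.2 le_top)).eq _ _

theorem Hess_apply (i j : Fin 2) (hu : ContDiffOn ℝ (⊤ : ℕ∞) u Ω) (hΩ : IsOpen Ω) (hx : x ∈ Ω) :
    Hess u x i j = pd i (pd j u) x := by
  rw [pd_pd_eq i j hu hΩ hx]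
  simp [Hess, iteratedFDeriv_two_apply]

theorem pd_comp_smul (i : Fin 2) (c : ℝ) (u : En 2 → ℝ) :
    pd i (fun y => u (c • y)) = fun x => c * pd i u (c • x) := by
  funext x
  simp [pd, fderiv_comp_smul]

theorem pd_const_mul (i : Fin 2) (c : ℝ) (hu : Differentiable ℝ u) :
    pd i (fun y => c * u y) = fun x => c * pd i u x := by
  funext x
  simp [pd, fderiv_const_mul (hu x)]

theorem pd_sum {ι : Type*} (i : Fin 2) (t : Finset ι) {F : ι → En 2 → ℝ}
    (hF : ∀ k ∈ t, Differentiable ℝ (F k)) :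
    pd i (fun y => ∑ k ∈ t, F k y) = fun x => ∑ k ∈ t, pd i (F k) x := by
  funext x
  simp [pd, fderiv_fun_sum (fun k hk => hF k hk x)]

theorem HasCompactSupport.pd (hu : HasCompactSupport u) (i : Fin 2) :
    HasCompactSupport (_root_.pd i u) :=
  hu.fderiv_apply ℝ _

theorem pd_eq_zero_of_eventuallyEq (i : Fin 2) {c : ℝ} (h : u =ᶠ[nhds x] fun _ => c) :
    pd i u x = 0 := by
  simp [pd, h.fderiv_eq]

end PartialDerivatives

/-- The integral of a partial derivative of a compactly supported function vanishes. -/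
theorem integral_pd_eq_zero (i : Fin 2) {F : En 2 → ℝ} (hF : ContDiff ℝ 1 F)
    (hc : HasCompactSupport F) : ∫ x, pd i F x = 0 := by
  have hcont : Continuous (pd i F) := (hF.pd (m := 0) (by simp) i).continuous
  have h := integral_mul_fderiv_eq_neg_fderiv_mul_of_integrable (μ := (volume : Measure (En 2)))
    (f := fun _ => (1 : ℝ)) (g := F) (v := EuclideanSpace.single i 1)
    (by simp)
    (by simp only [one_mul]; exact hcont.integrable_of_hasCompactSupport (hc.pd i))
    (by simpa using hF.continuous.integrable_of_hasCompactSupport hc)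
    (fun x _ => differentiableAt_const _) (fun x _ => (hF.differentiable (by simp)) x)
  simpa [pd] using h

/-- Extension by zero preserves smoothness when the function vanishes off a closed subset of the
open set on which it is smooth. -/
theorem contDiff_indicator {n : WithTop ℕ∞} {Ω K : Set (En 2)} {F : En 2 → ℝ} (hΩ : IsOpen Ω)
    (hK : IsClosed K) (hKΩ : K ⊆ Ω) (hF : ContDiffOn ℝ n F Ω) (h0 : ∀ x ∈ Ω, x ∉ K → F x = 0) :
    ContDiff ℝ n (Ω.indicator F) := by
  rw [contDiff_iff_contDiffAt]
  intro x
  by_cases hx : x ∈ Ω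
  · refine (hF.contDiffAt (hΩ.mem_nhds hx)).congr_of_eventuallyEq ?_
    filter_upwards [hΩ.mem_nhds hx] with y hy
    simp [hy]
  · refine (contDiffAt_const (c := (0 : ℝ))).congr_of_eventuallyEq ?_
    filter_upwards [hK.isOpen_compl.mem_nhds fun h => hx (hKΩ h)] with y hy
    by_cases hyΩ : y ∈ Ω
    · simp [hyΩ, h0 y hyΩ hy]
    · simp [hyΩ]

theorem hasCompactSupport_indicator {Ω K : Set (En 2)} {F : En 2 → ℝ} (hK : IsCompact K)
    (h0 : ∀ x ∈ Ω, x ∉ K → F x = 0) : HasCompactSupport (Ω.indicator F) :=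
  HasCompactSupport.intro hK fun x hx => by
    by_cases hxΩ : x ∈ Ω
    · simp [hxΩ, h0 x hxΩ hx]
    · simp [hxΩ]

/-- The planar divergence of the vector field `ψ · cof(D²s) ∇w`: the cofactor matrix of a Hessian
is divergence free. -/
theorem div_cofactor_flux {Ω : Set (En 2)} (hΩ : IsOpen Ω) {s w ψ : En 2 → ℝ}
    (hs : ContDiffOn ℝ (⊤ : ℕ∞) s Ω) (hw : ContDiffOn ℝ (⊤ : ℕ∞) w Ω) {x : En 2} (hx : x ∈ Ω)
    (hψ : DifferentiableAt ℝ ψ x)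
    (heq : pd 1 (pd 1 s) x * pd 0 (pd 0 w) x - 2 * (pd 0 (pd 1 s) x * pd 0 (pd 1 w) x)
      + pd 0 (pd 0 s) x * pd 1 (pd 1 w) x = 0) :
    pd 0 (fun y => ψ y * (pd 1 (pd 1 s) y * pd 0 w y - pd 0 (pd 1 s) y * pd 1 w y)) x
      + pd 1 (fun y => ψ y * (pd 0 (pd 0 s) y * pd 1 w y - pd 0 (pd 1 s) y * pd 0 w y)) x
    = pd 1 (pd 1 s) x * (pd 0 ψ x * pd 0 w x)
      - pd 0 (pd 1 s) x * (pd 0 ψ x * pd 1 w x + pd 1 ψ x * pd 0 w x)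
      + pd 0 (pd 0 s) x * (pd 1 ψ x * pd 1 w x) := by
  have hs1 := fun i => hs.smooth_pd hΩ i
  have hs2 := fun i j => (hs1 j).smooth_pd hΩ i
  have hw1 := fun i => hw.smooth_pd hΩ i
  have ds := fun i j => (hs2 i j).differentiableAt_of_isOpen hΩ hx
  have dw := fun i => (hw1 i).differentiableAt_of_isOpen hΩ hx
  rw [pd_mul 0 hψ (((ds 1 1).fun_mul (dw 0)).fun_sub ((ds 0 1).fun_mul (dw 1))),
    pd_mul 1 hψ (((ds 0 0).fun_mul (dw 1)).fun_sub ((ds 0 1).fun_mul (dw 0))),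
    pd_sub 0 ((ds 1 1).fun_mul (dw 0)) ((ds 0 1).fun_mul (dw 1)),
    pd_sub 1 ((ds 0 0).fun_mul (dw 1)) ((ds 0 1).fun_mul (dw 0)),
    pd_mul 0 (ds 1 1) (dw 0), pd_mul 0 (ds 0 1) (dw 1), pd_mul 1 (ds 0 0) (dw 1),
    pd_mul 1 (ds 0 1) (dw 0)]
  have e1 : pd 0 (pd 1 (pd 1 s)) x = pd 1 (pd 0 (pd 1 s)) x := pd_comm 0 1 (hs1 1) hΩ hx
  have e2 : pd 0 (pd 0 (pd 1 s)) x = pd 1 (pd 0 (pd 0 s)) x :=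
    (pd_congr 0 hΩ (pd_comm 0 1 hs hΩ) hx).trans (pd_comm 0 1 (hs1 0) hΩ hx)
  have e3 : pd 1 (pd 0 w) x = pd 0 (pd 1 w) x := pd_comm 1 0 hw hΩ hx
  rw [e1, e2, e3]
  linear_combination ψ x * heq

/-- The Laplacian of a function on the plane. -/
def lap (u : En 2 → ℝ) : En 2 → ℝ := fun x => pd 0 (pd 0 u) x + pd 1 (pd 1 u) x

theorem ContDiff.lap {u : En 2 → ℝ} (hu : ContDiff ℝ (⊤ : ℕ∞) u) :
    ContDiff ℝ (⊤ : ℕ∞) (_root_.lap u) :=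
  ((hu.smooth_pd 0).smooth_pd 0).add ((hu.smooth_pd 1).smooth_pd 1)

theorem HasCompactSupport.lap {u : En 2 → ℝ} (hu : HasCompactSupport u) :
    HasCompactSupport (_root_.lap u) :=
  ((hu.pd 0).pd 0).add ((hu.pd 1).pd 1)

theorem differentiable_of_smooth {u : En 2 → ℝ} (hu : ContDiff ℝ (⊤ : ℕ∞) u) :
    Differentiable ℝ u :=
  hu.differentiable (by simp)

theorem contDiff_comp_smul {u : En 2 → ℝ} (hu : ContDiff ℝ (⊤ : ℕ∞) u) (c : ℝ) :
    ContDiff ℝ (⊤ : ℕ∞) (fun y => u (c • y)) :=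
  hu.comp (contDiff_const_smul c)

theorem pd_pd_comp_smul (i : Fin 2) (c : ℝ) {u : En 2 → ℝ} (hu : ContDiff ℝ (⊤ : ℕ∞) u) :
    pd i (pd i (fun y => u (c • y))) = fun x => c ^ 2 * pd i (pd i u) (c • x) := by
  rw [pd_comp_smul, pd_const_mul i c
    (differentiable_of_smooth (contDiff_comp_smul (hu.smooth_pd i) c)), pd_comp_smul]
  funext x
  ring

theorem lap_comp_smul (c : ℝ) {u : En 2 → ℝ} (hu : ContDiff ℝ (⊤ : ℕ∞) u) :
    lap (fun y => u (c • y)) = fun x => c ^ 2 * lap u (c • x) := by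
  funext x
  simp only [lap, pd_pd_comp_smul _ c hu]
  ring

theorem pd_pd_const_mul (i : Fin 2) (c : ℝ) {u : En 2 → ℝ} (hu : ContDiff ℝ (⊤ : ℕ∞) u) :
    pd i (pd i (fun y => c * u y)) = fun x => c * pd i (pd i u) x := by
  rw [pd_const_mul i c (differentiable_of_smooth hu),
    pd_const_mul i c (differentiable_of_smooth (hu.smooth_pd i))]

theorem lap_const_mul (c : ℝ) {u : En 2 → ℝ} (hu : ContDiff ℝ (⊤ : ℕ∞) u) :
    lap (fun y => c * u y) = fun x => c * lap u x := by
  funext x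
  simp only [lap, pd_pd_const_mul _ c hu]
  ring

theorem lap_sum {ι : Type*} (t : Finset ι) {F : ι → En 2 → ℝ}
    (hF : ∀ k, ContDiff ℝ (⊤ : ℕ∞) (F k)) :
    lap (fun y => ∑ k ∈ t, F k y) = fun x => ∑ k ∈ t, lap (F k) x := by
  have h : ∀ i, pd i (pd i (fun y => ∑ k ∈ t, F k y)) = fun x => ∑ k ∈ t, pd i (pd i (F k)) x := by
    intro i
    rw [pd_sum i t fun k _ => differentiable_of_smooth (hF k),
      pd_sum i t fun k _ => differentiable_of_smooth ((hF k).smooth_pd i)]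
  funext x
  simp only [lap, h, Finset.sum_add_distrib]

theorem hasCompactSupport_comp_smul {u : En 2 → ℝ} (hu : HasCompactSupport u) {c : ℝ}
    (hc : c ≠ 0) : HasCompactSupport (fun y => u (c • y)) :=
  hu.comp_homeomorph (Homeomorph.smulOfNeZero c hc)

theorem hasCompactSupport_sum {ι : Type*} (t : Finset ι) {F : ι → En 2 → ℝ}
    (hF : ∀ k, HasCompactSupport (F k)) : HasCompactSupport (fun y => ∑ k ∈ t, F k y) := by
  classical
  induction t using Finset.induction_on with
  | empty =>
    simp only [Finset.sum_empty]
    exact HasCompactSupport.zero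
  | insert a t ha ih =>
    simp only [Finset.sum_insert ha]
    exact (hF a).add ih

theorem sq_sum_eq_sum_sq {ι : Type*} (t : Finset ι) (a : ι → ℝ)
    (h : ∀ k l, k ≠ l → a k * a l = 0) : (∑ k ∈ t, a k) ^ 2 = ∑ k ∈ t, a k ^ 2 := by
  rw [sq, Finset.sum_mul_sum]
  refine Finset.sum_congr rfl fun k hk => ?_
  rw [Finset.sum_eq_single_of_mem k hk fun l _ hl => h k l hl.symm, sq]

/-- The weighted integral `∫ |x|² |Δz|` scales like the square of the dilation factor. -/
theorem integral_sq_norm_mul_lap_comp_smul {z : En 2 → ℝ} (hz : ContDiff ℝ (⊤ : ℕ∞) z) {c : ℝ}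
    (hc : 0 < c) :
    ∫ x, ‖x‖ ^ 2 * |lap (fun y => z (c⁻¹ • y)) x| = c ^ 2 * ∫ x, ‖x‖ ^ 2 * |lap z x| := by
  have h := Measure.integral_comp_inv_smul_of_nonneg (volume : Measure (En 2))
    (fun x => ‖x‖ ^ 2 * |lap z x|) hc.le
  simp only [finrank_euclideanSpace, Fintype.card_fin, smul_eq_mul] at h
  rw [← h, lap_comp_smul _ hz]
  refine integral_congr_ae (Eventually.of_forall fun x => ?_)
  simp only [norm_smul, norm_inv, Real.norm_eq_abs, abs_mul, abs_pow, abs_inv, mul_pow]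
  ring

/-- Cutoff functions in the plane with small Dirichlet energy, measured in the weak sense needed
for Laplacians of functions of quadratic growth. -/
theorem exists_cutoff {R ε : ℝ} (hR : 0 < R) (hε : 0 < ε) :
    ∃ η ζ : En 2 → ℝ, ContDiff ℝ (⊤ : ℕ∞) η ∧ ContDiff ℝ (⊤ : ℕ∞) ζ ∧
      HasCompactSupport η ∧ HasCompactSupport ζ ∧ (∀ x, ‖x‖ < R → η x = 1) ∧
      (∀ x, ‖x‖ < R → ζ x = 0) ∧ (∀ x, pd 0 η x ^ 2 + pd 1 η x ^ 2 ≤ ζ x) ∧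
      ∫ x, ‖x‖ ^ 2 * |lap ζ x| ≤ ε := by
  let b : ContDiffBump (0 : En 2) := ⟨1, 2, one_pos, one_lt_two⟩
  let χ : En 2 → ℝ := b
  have hχ : ContDiff ℝ (⊤ : ℕ∞) χ := b.contDiff
  have hχc : HasCompactSupport χ := b.hasCompactSupport
  have hχ1 : ∀ x, ‖x‖ < 1 → χ x = 1 := fun x hx =>
    b.one_of_mem_closedBall (by simpa [b] using hx.le)
  have hχ0 : ∀ x, 2 < ‖x‖ → χ x = 0 := fun x hx =>
    b.zero_of_le_dist (by simpa [b] using hx.le)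
  have hpd_in : ∀ i x, ‖x‖ < 1 → pd i χ x = 0 := fun i x hx =>
    pd_eq_zero_of_eventuallyEq i (c := 1) <| by
      filter_upwards [(isOpen_lt continuous_norm continuous_const).mem_nhds hx] with y hy
        using hχ1 y hy
  have hpd_out : ∀ i x, 2 < ‖x‖ → pd i χ x = 0 := fun i x hx =>
    pd_eq_zero_of_eventuallyEq i (c := 0) <| by
      filter_upwards [(isOpen_lt continuous_const continuous_norm).mem_nhds hx] with y hy
        using hχ0 y hy
  let z : En 2 → ℝ := fun x => pd 0 χ x ^ 2 + pd 1 χ x ^ 2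
  have hz : ContDiff ℝ (⊤ : ℕ∞) z := ((hχ.smooth_pd 0).pow 2).add ((hχ.smooth_pd 1).pow 2)
  have hzc : HasCompactSupport z := by
    have h := fun i => ((hχc.pd i).mul_left (f := pd i χ))
    simpa [z, sq] using! (h 0).add (h 1)
  have hz_in : ∀ x, ‖x‖ < 1 → z x = 0 := fun x hx => by simp [z, hpd_in _ x hx]
  set C := ∫ x, ‖x‖ ^ 2 * |lap z x| with hC
  obtain ⟨n, hn⟩ := exists_nat_gt (C / ε)
  set N : ℝ := n + 1 with hN
  have hNpos : 0 < N := by positivity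
  let c : ℕ → ℝ := fun k => R * 4 ^ k
  have hc : ∀ k, 0 < c k := fun k => by positivity
  have hcR : ∀ k, R ≤ c k := fun k => le_mul_of_one_le_right hR.le (one_le_pow₀ (by norm_num))
  have hcin : ∀ k (x : En 2), ‖x‖ < c k → ‖(c k)⁻¹ • x‖ < 1 := fun k x hx => by
    rw [norm_smul, norm_inv, Real.norm_of_nonneg (hc k).le, inv_mul_lt_iff₀ (hc k)]
    simpa using hx
  have hcout : ∀ k (x : En 2), 2 * c k < ‖x‖ → 2 < ‖(c k)⁻¹ • x‖ := fun k x hx => by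
    rw [norm_smul, norm_inv, Real.norm_of_nonneg (hc k).le, lt_inv_mul_iff₀ (hc k)]
    linarith
  have hχk : ∀ k, ContDiff ℝ (⊤ : ℕ∞) (fun y => χ ((c k)⁻¹ • y)) := fun k =>
    contDiff_comp_smul hχ _
  have hzk : ∀ k, ContDiff ℝ (⊤ : ℕ∞) (fun y => z ((c k)⁻¹ • y)) := fun k =>
    contDiff_comp_smul hz _
  have hzk' : ∀ k, ContDiff ℝ (⊤ : ℕ∞) (fun y => ((c k)⁻¹) ^ 2 * z ((c k)⁻¹ • y)) := fun k =>
    contDiff_const.mul (hzk k)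
  have hsum : ContDiff ℝ (⊤ : ℕ∞) (fun y => ∑ k ∈ Finset.range (n + 1), χ ((c k)⁻¹ • y)) :=
    ContDiff.sum fun k _ => hχk k
  have hsumz : ContDiff ℝ (⊤ : ℕ∞)
      (fun y => ∑ k ∈ Finset.range (n + 1), ((c k)⁻¹) ^ 2 * z ((c k)⁻¹ • y)) :=
    ContDiff.sum fun k _ => hzk' k
  have hsumc : HasCompactSupport
      (fun y => ∑ k ∈ Finset.range (n + 1), χ ((c k)⁻¹ • y)) :=
    hasCompactSupport_sum _ fun k => hasCompactSupport_comp_smul hχc (inv_ne_zero (hc k).ne')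
  have hzkc : ∀ k, HasCompactSupport (fun y => ((c k)⁻¹) ^ 2 * z ((c k)⁻¹ • y)) := fun k =>
    (hasCompactSupport_comp_smul hzc (inv_ne_zero (hc k).ne')).mul_left
  have hsumzc : HasCompactSupport
      (fun y => ∑ k ∈ Finset.range (n + 1), ((c k)⁻¹) ^ 2 * z ((c k)⁻¹ • y)) :=
    hasCompactSupport_sum _ hzkc
  refine ⟨fun y => N⁻¹ * ∑ k ∈ Finset.range (n + 1), χ ((c k)⁻¹ • y),
    fun y => (N⁻¹) ^ 2 * ∑ k ∈ Finset.range (n + 1), ((c k)⁻¹) ^ 2 * z ((c k)⁻¹ • y),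
    contDiff_const.mul hsum, contDiff_const.mul hsumz, hsumc.mul_left, hsumzc.mul_left,
    fun x hx => ?_, fun x hx => ?_, fun x => le_of_eq ?_, ?_⟩
  · simp only [fun k => hχ1 _ (hcin k x (hx.trans_le (hcR k)))]
    simp [← hN, hNpos.ne']
  · simp [fun k => hz_in _ (hcin k x (hx.trans_le (hcR k)))]
  · have horth : ∀ i k l, k ≠ l →
        ((c k)⁻¹ * pd i χ ((c k)⁻¹ • x)) * ((c l)⁻¹ * pd i χ ((c l)⁻¹ • x)) = 0 := by
      intro i
      have key : ∀ k l, k < l →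
          ((c k)⁻¹ * pd i χ ((c k)⁻¹ • x)) * ((c l)⁻¹ * pd i χ ((c l)⁻¹ • x)) = 0 := by
        intro k l hkl
        rcases lt_or_ge ‖x‖ (c l) with h | h
        · rw [hpd_in i _ (hcin l x h)]; simp
        · have h4 : c (k + 1) ≤ c l :=
            mul_le_mul_of_nonneg_left (pow_le_pow_right₀ (by norm_num) hkl) hR.le
          have h5 : c (k + 1) = 4 * c k := by simp only [c]; ring
          rw [hpd_out i _ (hcout k x (by linarith [hc k]))]; simp
      intro k l hkl
      rcases lt_or_gt_of_ne hkl with h | h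
      · exact key k l h
      · rw [mul_comm]; exact key l k h
    have hpd : ∀ i, pd i (fun y => N⁻¹ * ∑ k ∈ Finset.range (n + 1), χ ((c k)⁻¹ • y)) x ^ 2
        = (N⁻¹) ^ 2 * ∑ k ∈ Finset.range (n + 1), ((c k)⁻¹ * pd i χ ((c k)⁻¹ • x)) ^ 2 := by
      intro i
      rw [pd_const_mul i _ (differentiable_of_smooth hsum),
        pd_sum i _ fun k _ => differentiable_of_smooth (hχk k)]
      simp only [pd_comp_smul]
      rw [mul_pow, sq_sum_eq_sum_sq _ _ (horth i)]
    rw [hpd, hpd, ← mul_add, ← Finset.sum_add_distrib]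
    refine congrArg _ (Finset.sum_congr rfl fun k _ => ?_)
    simp only [z]
    ring
  · have hint : ∀ k, Integrable (fun x => ‖x‖ ^ 2 *
        |lap (fun y => ((c k)⁻¹) ^ 2 * z ((c k)⁻¹ • y)) x|) := fun k =>
      ((continuous_norm.pow 2).mul (hzk' k).lap.continuous.abs).integrable_of_hasCompactSupport
        ((hzkc k).lap.abs.mul_left)
    have hval : ∀ k, ∫ x, ‖x‖ ^ 2 * |lap (fun y => ((c k)⁻¹) ^ 2 * z ((c k)⁻¹ • y)) x| = C := by
      intro k
      have h := integral_sq_norm_mul_lap_comp_smul hz (hc k)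
      rw [lap_const_mul _ (hzk k)]
      have h2 : ∀ x : En 2, ‖x‖ ^ 2 * |((c k)⁻¹) ^ 2 * lap (fun y => z ((c k)⁻¹ • y)) x|
          = ((c k)⁻¹) ^ 2 * (‖x‖ ^ 2 * |lap (fun y => z ((c k)⁻¹ • y)) x|) := fun x => by
        rw [abs_mul, abs_of_nonneg (by positivity : (0 : ℝ) ≤ ((c k)⁻¹) ^ 2)]
        ring
      simp only [h2]
      rw [integral_const_mul, h, ← mul_assoc, ← mul_pow, inv_mul_cancel₀ (hc k).ne', one_pow,
        one_mul]
    calc ∫ x, ‖x‖ ^ 2 * |lap (fun y => (N⁻¹) ^ 2 *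
          ∑ k ∈ Finset.range (n + 1), ((c k)⁻¹) ^ 2 * z ((c k)⁻¹ • y)) x|
        ≤ ∫ x, (N⁻¹) ^ 2 * ∑ k ∈ Finset.range (n + 1),
          ‖x‖ ^ 2 * |lap (fun y => ((c k)⁻¹) ^ 2 * z ((c k)⁻¹ • y)) x| := by
          refine integral_mono_of_nonneg (Eventually.of_forall fun x => by positivity)
            ((integrable_finsetSum _ fun k _ => hint k).const_mul _)
            (Eventually.of_forall fun x => ?_)
          simp only [lap_const_mul _ hsumz, lap_sum _ hzk']
          rw [abs_mul, abs_of_nonneg (by positivity : (0 : ℝ) ≤ (N⁻¹) ^ 2), ← Finset.mul_sum,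
            mul_left_comm]
          gcongr
          exact Finset.abs_sum_le_sum_abs _ _
      _ = C / N := by
          rw [integral_const_mul, integral_finsetSum _ fun k _ => hint k]
          simp only [hval]
          simp only [Finset.sum_const, Finset.card_range, nsmul_eq_mul, Nat.cast_add, Nat.cast_one,
            ← hN]
          field_simp
      _ ≤ ε := by
          rw [div_le_iff₀ hNpos]
          rw [div_lt_iff₀ hε] at hn
          nlinarith

theorem pd_indicator (i : Fin 2) {Ω K : Set (En 2)} {F : En 2 → ℝ} (hΩ : IsOpen Ω)
    (hK : IsClosed K) (hKΩ : K ⊆ Ω) (h0 : ∀ x ∈ Ω, x ∉ K → F x = 0) :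
    pd i (Ω.indicator F) = Ω.indicator (pd i F) := by
  funext x
  by_cases hx : x ∈ Ω
  · rw [Set.indicator_of_mem hx]
    exact pd_congr i hΩ (fun y hy => Set.indicator_of_mem hy F) hx
  · rw [Set.indicator_of_notMem hx]
    refine pd_eq_zero_of_eventuallyEq i (c := 0) ?_
    filter_upwards [hK.isOpen_compl.mem_nhds fun h => hx (hKΩ h)] with y hy
    by_cases hyΩ : y ∈ Ω
    · simp [hyΩ, h0 y hyΩ hy]
    · simp [hyΩ]

theorem pd_eq_zero_of_notMem_tsupport (i : Fin 2) {u : En 2 → ℝ} {x : En 2}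
    (hx : x ∉ tsupport u) : pd i u x = 0 :=
  pd_eq_zero_of_eventuallyEq i (c := 0) (notMem_tsupport_iff_eventuallyEq.1 hx)

theorem lap_eq_zero_of_notMem_tsupport {u : En 2 → ℝ} {x : En 2} (hx : x ∉ tsupport u) :
    lap u x = 0 := by
  have h : ∀ i, tsupport (pd i u) ⊆ tsupport u := fun i => tsupport_fderiv_apply_subset ℝ _
  simp [lap, pd_eq_zero_of_notMem_tsupport _ fun hx' => hx (h _ hx')]

/-- Green's identity moves the Laplacian of a function of at most quadratic growth onto the test
function. -/
theorem integral_lap_mul_le {Ω : Set (En 2)} (hΩ : IsOpen Ω) {s ζ : En 2 → ℝ} {C : ℝ}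
    (hs : ContDiffOn ℝ (⊤ : ℕ∞) s Ω) (hζ : ContDiff ℝ (⊤ : ℕ∞) ζ) (hζc : HasCompactSupport ζ)
    (hsupp : tsupport ζ ⊆ Ω) (hgrow : ∀ x ∈ tsupport ζ, |s x| ≤ C * ‖x‖ ^ 2) :
    Integrable (Ω.indicator fun x => lap s x * ζ x) ∧
      ∫ x, Ω.indicator (fun x => lap s x * ζ x) x ≤ C * ∫ x, ‖x‖ ^ 2 * |lap ζ x| := by
  let F : Fin 2 → En 2 → ℝ := fun i x => ζ x * pd i s x - s x * pd i ζ x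
  have hcl : IsClosed (tsupport ζ) := isClosed_tsupport ζ
  have hF0 : ∀ i, ∀ x ∈ Ω, x ∉ tsupport ζ → F i x = 0 := fun i x _ hx => by
    simp [F, image_eq_zero_of_notMem_tsupport hx, pd_eq_zero_of_notMem_tsupport i hx]
  have hFs : ∀ i, ContDiffOn ℝ (⊤ : ℕ∞) (F i) Ω := fun i =>
    (hζ.contDiffOn.mul (hs.smooth_pd hΩ i)).sub (hs.mul (hζ.smooth_pd i).contDiffOn)
  have hFi : ∀ i, ContDiff ℝ 1 (Ω.indicator (F i)) := fun i =>
    (contDiff_indicator hΩ hcl hsupp (hFs i) (hF0 i)).of_le (WithTop.coe_le_coe.2 le_top)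
  have hFc : ∀ i, HasCompactSupport (Ω.indicator (F i)) := fun i =>
    hasCompactSupport_indicator hζc (hF0 i)
  have hFint : ∀ i, Integrable (pd i (Ω.indicator (F i))) := fun i =>
    ((hFi i).pd (m := 0) (by simp) i).continuous.integrable_of_hasCompactSupport ((hFc i).pd i)
  have hSl0 : ∀ x ∈ Ω, x ∉ tsupport ζ → s x * lap ζ x = 0 := fun x _ hx => by
    simp [lap_eq_zero_of_notMem_tsupport hx]
  have hSint : Integrable (Ω.indicator fun x => s x * lap ζ x) :=
    (contDiff_indicator hΩ hcl hsupp (hs.mul hζ.lap.contDiffOn)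
      hSl0).continuous.integrable_of_hasCompactSupport (hasCompactSupport_indicator hζc hSl0)
  have hWint : Integrable (fun x : En 2 => ‖x‖ ^ 2 * |lap ζ x|) :=
    ((continuous_norm.pow 2).mul hζ.lap.continuous.abs).integrable_of_hasCompactSupport
      hζc.lap.abs.mul_left
  have hid : (Ω.indicator fun x => lap s x * ζ x) =
      pd 0 (Ω.indicator (F 0)) + pd 1 (Ω.indicator (F 1))
        + Ω.indicator (fun x => s x * lap ζ x) := by
    funext x
    rw [Pi.add_apply, Pi.add_apply, pd_indicator 0 hΩ hcl hsupp (hF0 0),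
      pd_indicator 1 hΩ hcl hsupp (hF0 1)]
    by_cases hx : x ∈ Ω
    · simp only [Set.indicator_of_mem hx]
      have ds := hs.differentiableAt_of_isOpen hΩ hx
      have dζ := differentiable_of_smooth hζ x
      have ds' := fun i => (hs.smooth_pd hΩ i).differentiableAt_of_isOpen hΩ hx
      have dζ' := fun i => differentiable_of_smooth (hζ.smooth_pd i) x
      have hdiv : ∀ i, pd i (F i) x = ζ x * pd i (pd i s) x - s x * pd i (pd i ζ) x := fun i => by
        simp only [F]
        rw [pd_sub i (dζ.fun_mul (ds' i)) (ds.fun_mul (dζ' i)), pd_mul i dζ (ds' i),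
          pd_mul i ds (dζ' i)]
        ring
      rw [hdiv, hdiv]
      simp only [lap]
      ring
    · simp [hx]
  rw [hid]
  refine ⟨((hFint 0).add (hFint 1)).add hSint, ?_⟩
  rw [integral_add' ((hFint 0).add (hFint 1)) hSint, integral_add' (hFint 0) (hFint 1),
    integral_pd_eq_zero 0 (hFi 0) (hFc 0), integral_pd_eq_zero 1 (hFi 1) (hFc 1), zero_add,
    zero_add, ← integral_const_mul]
  refine integral_mono hSint (hWint.const_mul C) fun x => ?_
  by_cases hx : x ∈ tsupport ζ
  · simp only [Set.indicator_of_mem (hsupp hx)]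
    calc s x * lap ζ x ≤ |s x * lap ζ x| := le_abs_self _
      _ = |s x| * |lap ζ x| := abs_mul _ _
      _ ≤ C * ‖x‖ ^ 2 * |lap ζ x| := by gcongr; exact hgrow x hx
      _ = C * (‖x‖ ^ 2 * |lap ζ x|) := mul_assoc _ _ _
  · by_cases hxΩ : x ∈ Ω <;> simp [hxΩ, lap_eq_zero_of_notMem_tsupport hx]

theorem hasDerivAt_max_zero_sq (r : ℝ) :
    HasDerivAt (fun t : ℝ => max t 0 ^ 2) (2 * max r 0) r := by
  rcases lt_trichotomy r 0 with h | h | h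
  · rw [max_eq_right h.le, mul_zero]
    refine (hasDerivAt_const r (0 : ℝ)).congr_of_eventuallyEq ?_
    filter_upwards [gt_mem_nhds h] with t ht
    simp [max_eq_right ht.le]
  · subst h
    rw [hasDerivAt_iff_isLittleO]
    simp only [max_self, mul_zero, sub_zero, smul_zero, ne_eq, OfNat.ofNat_ne_zero,
      not_false_eq_true, zero_pow]
    refine Asymptotics.IsBigO.trans_isLittleO (g := fun t : ℝ => t ^ 2) ?_ ?_
    · refine Asymptotics.isBigO_of_le _ fun t => ?_
      rw [norm_pow, norm_pow]
      refine pow_le_pow_left₀ (norm_nonneg _) ?_ 2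
      rw [Real.norm_eq_abs, Real.norm_eq_abs, abs_of_nonneg (le_max_right _ _)]
      exact max_le (le_abs_self t) (abs_nonneg t)
    · simpa using Asymptotics.isLittleO_pow_pow (𝕜 := ℝ) (m := 1) (n := 2) (by norm_num)
  · rw [max_eq_left h.le]
    have h2 : HasDerivAt (fun t : ℝ => t ^ 2) (2 * r) r := by simpa using hasDerivAt_pow 2 r
    refine h2.congr_of_eventuallyEq ?_
    filter_upwards [lt_mem_nhds h] with t ht
    simp [max_eq_left ht.le]

theorem contDiff_max_zero_sq : ContDiff ℝ 1 (fun t : ℝ => max t 0 ^ 2) := by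
  rw [contDiff_one_iff_deriv]
  refine ⟨fun r => (hasDerivAt_max_zero_sq r).differentiableAt, ?_⟩
  rw [funext fun r => (hasDerivAt_max_zero_sq r).deriv]
  fun_prop

/-- The quadratic form of the cofactor matrix of `D²s(x)`. -/
def cofForm (s : En 2 → ℝ) (x : En 2) (a b : ℝ) : ℝ :=
  pd 1 (pd 1 s) x * a ^ 2 - 2 * (pd 0 (pd 1 s) x * (a * b)) + pd 0 (pd 0 s) x * b ^ 2

theorem ContDiffOn.continuousOn_cofForm {Ω : Set (En 2)} (hΩ : IsOpen Ω) {s p q : En 2 → ℝ}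
    (hs : ContDiffOn ℝ (⊤ : ℕ∞) s Ω) (hp : ContinuousOn p Ω) (hq : ContinuousOn q Ω) :
    ContinuousOn (fun x => cofForm s x (p x) (q x)) Ω := by
  have h := fun i j => ((hs.smooth_pd hΩ j).smooth_pd hΩ i).continuousOn
  exact (((h 1 1).mul (hp.pow 2)).sub (continuousOn_const.mul ((h 0 1).mul (hp.mul hq)))).add
    ((h 0 0).mul (hq.pow 2))

/-- Caccioppoli's inequality for a solution of `div (cof(D²s) ∇w) = 0` that is nonpositive off a
closed subset of the domain. -/
theorem caccioppoli {Ω K : Set (En 2)} (hΩ : IsOpen Ω) (hK : IsClosed K) (hKΩ : K ⊆ Ω)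
    {s w η ζ : En 2 → ℝ} {B : ℝ}
    (hs : ContDiffOn ℝ (⊤ : ℕ∞) s Ω) (hw : ContDiffOn ℝ (⊤ : ℕ∞) w Ω)
    (hQ : ∀ x ∈ Ω, ∀ a b, 0 ≤ cofForm s x a b)
    (heq : ∀ x ∈ Ω, pd 1 (pd 1 s) x * pd 0 (pd 0 w) x
      - 2 * (pd 0 (pd 1 s) x * pd 0 (pd 1 w) x) + pd 0 (pd 0 s) x * pd 1 (pd 1 w) x = 0)
    (hwK : ∀ x ∈ Ω, x ∉ K → w x ≤ 0) (hB : 0 ≤ B) (hwB : ∀ x ∈ Ω, w x ≤ B)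
    (hη : ContDiff ℝ (⊤ : ℕ∞) η) (hηc : HasCompactSupport η)
    (hηζ : ∀ x, pd 0 η x ^ 2 + pd 1 η x ^ 2 ≤ ζ x)
    (hint : Integrable (Ω.indicator fun x => lap s x * ζ x)) :
    ∫ x, η x ^ 2 * Ω.indicator (fun y => max (w y) 0 * cofForm s y (pd 0 w y) (pd 1 w y)) x
      ≤ B ^ 3 * ∫ x, Ω.indicator (fun x => lap s x * ζ x) x := by
  let ψ : En 2 → ℝ := fun x => η x ^ 2 * max (w x) 0 ^ 2
  let X₀ : En 2 → ℝ := fun y => ψ y * (pd 1 (pd 1 s) y * pd 0 w y - pd 0 (pd 1 s) y * pd 1 w y)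
  let X₁ : En 2 → ℝ := fun y => ψ y * (pd 0 (pd 0 s) y * pd 1 w y - pd 0 (pd 1 s) y * pd 0 w y)
  have one_le : (1 : WithTop ℕ∞) ≤ ((⊤ : ℕ∞) : WithTop ℕ∞) := WithTop.coe_le_coe.2 le_top
  have hψ : ContDiffOn ℝ 1 ψ Ω :=
    ((hη.of_le one_le).pow 2).contDiffOn.mul
      (contDiff_max_zero_sq.comp_contDiffOn (hw.of_le one_le))
  have hs2 := fun i j => ((hs.smooth_pd hΩ j).smooth_pd hΩ i).of_le one_le
  have hw1 := fun i => (hw.smooth_pd hΩ i).of_le one_le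
  have hX₀ : ContDiffOn ℝ 1 X₀ Ω :=
    hψ.mul (((hs2 1 1).mul (hw1 0)).sub ((hs2 0 1).mul (hw1 1)))
  have hX₁ : ContDiffOn ℝ 1 X₁ Ω :=
    hψ.mul (((hs2 0 0).mul (hw1 1)).sub ((hs2 0 1).mul (hw1 0)))
  have hLc : IsCompact (tsupport η ∩ K) := hηc.inter_right hK
  have hLΩ : tsupport η ∩ K ⊆ Ω := Set.inter_subset_right.trans hKΩ
  have hψ0 : ∀ x ∈ Ω, x ∉ tsupport η ∩ K → ψ x = 0 := fun x hx hxL => by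
    by_cases h : x ∈ tsupport η
    · simp [ψ, max_eq_right (hwK x hx fun h' => hxL ⟨h, h'⟩)]
    · simp [ψ, image_eq_zero_of_notMem_tsupport h]
  have hX₀0 : ∀ x ∈ Ω, x ∉ tsupport η ∩ K → X₀ x = 0 := fun x hx hxL => by
    simp [X₀, hψ0 x hx hxL]
  have hX₁0 : ∀ x ∈ Ω, x ∉ tsupport η ∩ K → X₁ x = 0 := fun x hx hxL => by
    simp [X₁, hψ0 x hx hxL]
  have hi₀ := contDiff_indicator hΩ hLc.isClosed hLΩ hX₀ hX₀0
  have hi₁ := contDiff_indicator hΩ hLc.isClosed hLΩ hX₁ hX₁0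
  have hc₀ := hasCompactSupport_indicator hLc hX₀0
  have hc₁ := hasCompactSupport_indicator hLc hX₁0
  have hint₀ : Integrable (pd 0 (Ω.indicator X₀)) :=
    (hi₀.pd (m := 0) (by simp) 0).continuous.integrable_of_hasCompactSupport (hc₀.pd 0)
  have hint₁ : Integrable (pd 1 (Ω.indicator X₁)) :=
    (hi₁.pd (m := 0) (by simp) 1).continuous.integrable_of_hasCompactSupport (hc₁.pd 1)
  have hzero : ∫ x, (pd 0 (Ω.indicator X₀) x + pd 1 (Ω.indicator X₁) x) = 0 := by
    rw [integral_add hint₀ hint₁, integral_pd_eq_zero 0 hi₀ hc₀, integral_pd_eq_zero 1 hi₁ hc₁,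
      add_zero]
  have hle : ∀ x, η x ^ 2 *
        Ω.indicator (fun y => max (w y) 0 * cofForm s y (pd 0 w y) (pd 1 w y)) x
      ≤ (pd 0 (Ω.indicator X₀) x + pd 1 (Ω.indicator X₁) x)
        + B ^ 3 * Ω.indicator (fun x => lap s x * ζ x) x := by
    intro x
    rw [pd_indicator 0 hΩ hLc.isClosed hLΩ hX₀0, pd_indicator 1 hΩ hLc.isClosed hLΩ hX₁0]
    by_cases hx : x ∈ Ω
    · simp only [Set.indicator_of_mem hx]
      have dw := hw.differentiableAt_of_isOpen hΩ hx
      have dη := differentiable_of_smooth hη x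
      have dη2 : HasDerivAt (fun r : ℝ => r ^ 2) (2 * η x) (η x) := by
        simpa using hasDerivAt_pow 2 (η x)
      have hψd : DifferentiableAt ℝ ψ x :=
        (hψ.contDiffAt (hΩ.mem_nhds hx)).differentiableAt (by simp)
      have hpdψ : ∀ i, pd i ψ x
          = η x ^ 2 * (2 * max (w x) 0 * pd i w x)
            + max (w x) 0 ^ 2 * (2 * η x * pd i η x) := fun i => by
        simp only [ψ]
        have dm : DifferentiableAt ℝ (fun y => max (w y) 0 ^ 2) x :=
          (hasDerivAt_max_zero_sq (w x)).differentiableAt.comp x dw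
        rw [pd_mul i (dη.fun_pow 2) dm, pd_comp i dη dη2,
          pd_comp i dw (hasDerivAt_max_zero_sq (w x))]
      have hdiv := div_cofactor_flux hΩ hs hw hx hψd (heq x hx)
      change pd 0 X₀ x + pd 1 X₁ x = _ at hdiv
      rw [hdiv, hpdψ, hpdψ]
      set t := max (w x) 0 with ht
      have ht0 : 0 ≤ t := le_max_right _ _
      have htB : t ≤ B := max_le (hwB x hx) hB
      have h11 : 0 ≤ pd 1 (pd 1 s) x := by simpa [cofForm] using hQ x hx 1 0
      have h00 : 0 ≤ pd 0 (pd 0 s) x := by simpa [cofForm] using hQ x hx 0 1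
      have hsq := mul_nonneg ht0
        (hQ x hx (η x * pd 0 w x + t * pd 0 η x) (η x * pd 1 w x + t * pd 1 η x))
      have htr := hQ x hx (-pd 1 η x) (pd 0 η x)
      have hlap : 0 ≤ lap s x := add_nonneg h00 h11
      have hηle : cofForm s x (pd 0 η x) (pd 1 η x) ≤ lap s x * ζ x := by
        refine le_trans ?_ (mul_le_mul_of_nonneg_left (hηζ x) hlap)
        simp only [cofForm, lap] at htr ⊢
        linarith
      have h3 : t ^ 3 * cofForm s x (pd 0 η x) (pd 1 η x) ≤ B ^ 3 * (lap s x * ζ x) := by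
        refine mul_le_mul (pow_le_pow_left₀ ht0 htB 3) hηle (hQ x hx _ _) (pow_nonneg hB 3)
      simp only [cofForm] at hsq h3 ⊢
      linarith
    · simp [hx]
  have hsum := (hint₀.add hint₁).add (hint.const_mul (B ^ 3))
  have hnn : ∀ x, 0 ≤ η x ^ 2 *
      Ω.indicator (fun y => max (w y) 0 * cofForm s y (pd 0 w y) (pd 1 w y)) x := fun x =>
    mul_nonneg (sq_nonneg _)
      (Set.indicator_nonneg (fun y hy => mul_nonneg (le_max_right _ _) (hQ y hy _ _)) x)
  refine (integral_mono_of_nonneg (Eventually.of_forall hnn) hsum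
    (Eventually.of_forall hle)).trans (le_of_eq ?_)
  refine (integral_add (hint₀.add hint₁) (hint.const_mul (B ^ 3))).trans ?_
  rw [integral_const_mul]
  refine (congrArg (· + _) hzero).trans (zero_add _)

/-- Liouville-type vanishing of the energy density for bounded solutions of
`div (cof(D²s) ∇w) = 0` outside a compact set when `s` has at most quadratic growth. -/
theorem energy_density_eq_zero {Ω K : Set (En 2)} (hΩ : IsOpen Ω) (hK : IsClosed K) (hKΩ : K ⊆ Ω)
    {s w : En 2 → ℝ} {B C R : ℝ}
    (hs : ContDiffOn ℝ (⊤ : ℕ∞) s Ω) (hw : ContDiffOn ℝ (⊤ : ℕ∞) w Ω)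
    (hQ : ∀ x ∈ Ω, ∀ a b, 0 ≤ cofForm s x a b)
    (heq : ∀ x ∈ Ω, pd 1 (pd 1 s) x * pd 0 (pd 0 w) x
      - 2 * (pd 0 (pd 1 s) x * pd 0 (pd 1 w) x) + pd 0 (pd 0 s) x * pd 1 (pd 1 w) x = 0)
    (hwK : ∀ x ∈ Ω, x ∉ K → w x ≤ 0) (hB : 0 ≤ B) (hwB : ∀ x ∈ Ω, w x ≤ B)
    (hR : 0 < R) (hRΩ : ∀ x, R ≤ ‖x‖ → x ∈ Ω) (hC : 0 ≤ C)
    (hgrow : ∀ x, R ≤ ‖x‖ → |s x| ≤ C * ‖x‖ ^ 2) {x : En 2} (hx : x ∈ Ω) (hwx : 0 < w x) :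
    cofForm s x (pd 0 w x) (pd 1 w x) = 0 := by
  set h : En 2 → ℝ :=
    Ω.indicator (fun y => max (w y) 0 * cofForm s y (pd 0 w y) (pd 1 w y)) with hdef
  have hnn : ∀ y, 0 ≤ h y := fun y =>
    Set.indicator_nonneg (fun y hy => mul_nonneg (le_max_right _ _) (hQ y hy _ _)) y
  have hcont : Continuous h := by
    rw [← contDiff_zero (𝕜 := ℝ)]
    refine contDiff_indicator hΩ hK hKΩ ?_ fun y hy hyK => by simp [max_eq_right (hwK y hy hyK)]
    exact contDiffOn_zero.2 (((continuous_id.max continuous_const).comp_continuousOn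
      hw.continuousOn).mul
      (hs.continuousOn_cofForm hΩ (hw.smooth_pd hΩ 0).continuousOn
        (hw.smooth_pd hΩ 1).continuousOn))
  set ρ := max R ‖x‖ + 1 with hρ
  have hRρ : R ≤ ρ := (le_max_left _ _).trans (by linarith)
  have hxρ : x ∈ Metric.ball (0 : En 2) ρ := by
    rw [mem_ball_zero_iff]
    exact (le_max_right R ‖x‖).trans_lt (by linarith)
  have hsmall : ∀ ε > 0, ∫ y in Metric.ball (0 : En 2) ρ, h y ≤ B ^ 3 * (C * ε) := by
    intro ε hε
    obtain ⟨η, ζ, hη, hζ, hηc, hζc, hη1, hζ0, hηζ, hζε⟩ :=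
      exists_cutoff (hR.trans_le hRρ) hε
    have hsupp : ∀ y ∈ tsupport ζ, R ≤ ‖y‖ := by
      have hcl : IsClosed {y : En 2 | R ≤ ‖y‖} := isClosed_le continuous_const continuous_norm
      refine closure_minimal (fun y hy => ?_) hcl
      by_contra hlt
      exact hy (hζ0 y ((not_le.1 hlt).trans_le hRρ))
    obtain ⟨hint, hle⟩ := integral_lap_mul_le hΩ hs hζ hζc (fun y hy => hRΩ y (hsupp y hy))
      fun y hy => hgrow y (hsupp y hy)
    have hcacc := caccioppoli hΩ hK hKΩ hs hw hQ heq hwK hB hwB hη hηc hηζ hint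
    have hηint : Integrable (fun y => η y ^ 2 * h y) :=
      ((hη.continuous.pow 2).mul hcont).integrable_of_hasCompactSupport
        ((by simpa [sq] using! hηc.mul_left (f := η) :
          HasCompactSupport fun y => η y ^ 2).mul_right)
    calc ∫ y in Metric.ball (0 : En 2) ρ, h y
        = ∫ y, (Metric.ball (0 : En 2) ρ).indicator h y :=
          (integral_indicator Metric.isOpen_ball.measurableSet).symm
      _ ≤ ∫ y, η y ^ 2 * h y := by
          refine integral_mono_of_nonneg
            (Eventually.of_forall fun y => Set.indicator_nonneg (fun y _ => hnn y) y) hηint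
            (Eventually.of_forall fun y => ?_)
          by_cases hy : y ∈ Metric.ball (0 : En 2) ρ
          · simp [Set.indicator_of_mem hy, hη1 y (mem_ball_zero_iff.1 hy)]
          · simp only [Set.indicator_of_notMem hy]
            exact mul_nonneg (sq_nonneg _) (hnn y)
      _ ≤ B ^ 3 * (C * ε) := hcacc.trans (mul_le_mul_of_nonneg_left
          (hle.trans (mul_le_mul_of_nonneg_left hζε hC)) (pow_nonneg hB 3))
  have hzero : ∫ y in Metric.ball (0 : En 2) ρ, h y = 0 := by
    refine le_antisymm (le_of_forall_pos_le_add fun ε hε => ?_)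
      (integral_nonneg fun y => hnn y)
    refine (hsmall (ε / (B ^ 3 * C + 1)) (by positivity)).trans ?_
    rw [zero_add, ← mul_assoc, ← mul_div_assoc, div_le_iff₀ (by positivity)]
    nlinarith [mul_nonneg (pow_nonneg hB 3) hC]
  have hintb : IntegrableOn h (Metric.ball (0 : En 2) ρ) :=
    (hcont.continuousOn.integrableOn_compact (isCompact_closedBall (0 : En 2) ρ)).mono_set
      Metric.ball_subset_closedBall
  have hae : h =ᵐ[volume.restrict (Metric.ball (0 : En 2) ρ)] fun _ => 0 :=
    (setIntegral_eq_zero_iff_of_nonneg_ae (Eventually.of_forall hnn) hintb).1 hzero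
  have hpt : h x = 0 := Measure.eqOn_open_of_ae_eq hae Metric.isOpen_ball hcont.continuousOn
    continuousOn_const hxρ
  rw [hdef, Set.indicator_of_mem hx, max_eq_left hwx.le] at hpt
  exact (mul_eq_zero.1 hpt).resolve_left hwx.ne'

theorem fderiv_eq_zero_of_pd {u : En 2 → ℝ} {x : En 2} (h : ∀ i, pd i u x = 0) :
    fderiv ℝ u x = 0 := by
  ext v
  have hv : v = v 0 • EuclideanSpace.single 0 (1 : ℝ) + v 1 • EuclideanSpace.single 1 (1 : ℝ) := by
    ext i
    fin_cases i <;> simp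
  have h0 := h 0
  have h1 := h 1
  simp only [pd] at h0 h1
  rw [hv, map_add, map_smul, map_smul, h0, h1]
  simp

theorem cofForm_nonneg {Ω : Set (En 2)} (hΩ : IsOpen Ω) {u : En 2 → ℝ} {x : En 2}
    (hu : ContDiffOn ℝ (⊤ : ℕ∞) u Ω) (hx : x ∈ Ω) (h : (Hess u x).PosSemidef) (a b : ℝ) :
    0 ≤ cofForm u x a b := by
  have h2 := h.dotProduct_mulVec_nonneg ![b, -a]
  simp only [Matrix.mulVec, dotProduct, Fin.sum_univ_two, star_trivial, Hess_apply _ _ hu hΩ hx,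
    Matrix.cons_val_zero, Matrix.cons_val_one] at h2
  rw [pd_comm 1 0 hu hΩ hx] at h2
  simp only [cofForm]
  linarith

theorem det_Hess_eq {Ω : Set (En 2)} (hΩ : IsOpen Ω) {u : En 2 → ℝ} {x : En 2}
    (hu : ContDiffOn ℝ (⊤ : ℕ∞) u Ω) (hx : x ∈ Ω) :
    (Hess u x).det = pd 0 (pd 0 u) x * pd 1 (pd 1 u) x - pd 0 (pd 1 u) x ^ 2 := by
  rw [Matrix.det_fin_two]
  simp only [Hess_apply _ _ hu hΩ hx]
  rw [pd_comm 1 0 hu hΩ hx, sq]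

theorem eq_zero_of_cofForm_eq_zero {u : En 2 → ℝ} {x : En 2} {a b : ℝ}
    (hdet : 0 < pd 0 (pd 0 u) x * pd 1 (pd 1 u) x - pd 0 (pd 1 u) x ^ 2)
    (h : cofForm u x a b = 0) : a = 0 ∧ b = 0 := by
  simp only [cofForm] at h
  set p := pd 0 (pd 0 u) x
  set q := pd 1 (pd 1 u) x
  set r := pd 0 (pd 1 u) x
  have hb : b = 0 := by
    have h1 : (q * a - r * b) ^ 2 + (p * q - r ^ 2) * b ^ 2 = 0 := by linear_combination q * h
    have h2 : (p * q - r ^ 2) * b ^ 2 = 0 :=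
      le_antisymm (by linarith [sq_nonneg (q * a - r * b)]) (mul_nonneg hdet.le (sq_nonneg b))
    exact pow_eq_zero_iff two_ne_zero |>.1 ((mul_eq_zero.1 h2).resolve_left hdet.ne')
  have hq : q ≠ 0 := by
    intro hq
    rw [hq] at hdet
    nlinarith [sq_nonneg r]
  rw [hb] at h
  have h3 : q * a ^ 2 = 0 := by linear_combination h
  exact ⟨pow_eq_zero_iff two_ne_zero |>.1 ((mul_eq_zero.1 h3).resolve_left hq), hb⟩

theorem abs_le_sq_growth {d r M u : ℝ} (hr : 1 ≤ r)
    (h : |u - r ^ 2 / 2 - d * Real.log r| ≤ M) : |u| ≤ (1 / 2 + |d| + |M|) * r ^ 2 := by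
  have hr2 : r ≤ r ^ 2 := by nlinarith
  have hlog0 : 0 ≤ Real.log r := Real.log_nonneg hr
  have hlog : Real.log r ≤ r ^ 2 := (Real.log_le_self (by linarith)).trans hr2
  have hM : M ≤ |M| * r ^ 2 := (le_abs_self M).trans
    (le_mul_of_one_le_right (abs_nonneg M) (hr.trans hr2))
  have hd : |d * Real.log r| ≤ |d| * r ^ 2 := by
    rw [abs_mul, abs_of_nonneg hlog0]
    gcongr
  have h1 := abs_le.1 h
  have h2 := abs_le.1 hd
  rw [abs_le]
  constructor <;> nlinarith

theorem ExtU.le {D : Set (En 2)} (hDo : IsOpen D) (hDb : Bornology.IsBounded D)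
    (hDne : D.Nonempty) {f φ : En 2 → ℝ} (hf : ∀ x, 0 < f x) {d : ℝ} {u₁ u₂ : En 2 → ℝ}
    (h₁ : ExtU D f φ d u₁) (h₂ : ExtU D f φ d u₂) {x : En 2} (hx : x ∈ (closure D)ᶜ) :
    u₁ x ≤ u₂ x := by
  obtain ⟨c₁, s₁, e₁, b₁, M₁, m₁⟩ := h₁
  obtain ⟨c₂, s₂, e₂, b₂, M₂, m₂⟩ := h₂
  refine le_of_forall_pos_le_add fun δ hδ => ?_
  set Ω := (closure D)ᶜ with hΩdef
  have hΩ : IsOpen Ω := isClosed_closure.isOpen_compl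
  have hΩD : Ω ⊆ Dᶜ := Set.compl_subset_compl.2 subset_closure
  let s : En 2 → ℝ := fun y => u₁ y + u₂ y
  let v : En 2 → ℝ := fun y => u₁ y - u₂ y
  let w : En 2 → ℝ := fun y => v y - δ
  have hs : ContDiffOn ℝ (⊤ : ℕ∞) s Ω := s₁.add s₂
  have hv : ContDiffOn ℝ (⊤ : ℕ∞) v Ω := s₁.sub s₂
  have hw : ContDiffOn ℝ (⊤ : ℕ∞) w Ω := hv.sub contDiffOn_const
  have hs1 : ∀ i, Set.EqOn (pd i s) (fun y => pd i u₁ y + pd i u₂ y) Ω := fun i y hy =>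
    pd_add i (s₁.differentiableAt_of_isOpen hΩ hy) (s₂.differentiableAt_of_isOpen hΩ hy)
  have hw1 : ∀ i, Set.EqOn (pd i w) (fun y => pd i u₁ y - pd i u₂ y) Ω := fun i y hy => by
    have h1 := pd_sub i (hv.differentiableAt_of_isOpen hΩ hy)
      (differentiableAt_const δ : DifferentiableAt ℝ (fun _ => δ) y)
    rw [pd_eq_zero_of_eventuallyEq i (u := fun _ => δ) (Eventually.of_forall fun _ => rfl),
      sub_zero] at h1
    exact h1.trans (pd_sub i (s₁.differentiableAt_of_isOpen hΩ hy)
      (s₂.differentiableAt_of_isOpen hΩ hy))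
  have hs2 : ∀ i j, ∀ y ∈ Ω, pd i (pd j s) y = pd i (pd j u₁) y + pd i (pd j u₂) y :=
    fun i j y hy => (pd_congr i hΩ (hs1 j) hy).trans
      (pd_add i ((s₁.smooth_pd hΩ j).differentiableAt_of_isOpen hΩ hy)
        ((s₂.smooth_pd hΩ j).differentiableAt_of_isOpen hΩ hy))
  have hw2 : ∀ i j, ∀ y ∈ Ω, pd i (pd j w) y = pd i (pd j u₁) y - pd i (pd j u₂) y :=
    fun i j y hy => (pd_congr i hΩ (hw1 j) hy).trans
      (pd_sub i ((s₁.smooth_pd hΩ j).differentiableAt_of_isOpen hΩ hy)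
        ((s₂.smooth_pd hΩ j).differentiableAt_of_isOpen hΩ hy))
  have hcof : ∀ y ∈ Ω, ∀ a b, cofForm s y a b = cofForm u₁ y a b + cofForm u₂ y a b := by
    intro y hy a b
    simp only [cofForm, hs2 _ _ y hy]
    ring
  have hn₁ := fun y hy => cofForm_nonneg hΩ s₁ hy (e₁ y hy).1
  have hn₂ := fun y hy => cofForm_nonneg hΩ s₂ hy (e₂ y hy).1
  have hd₁ := fun y hy => (det_Hess_eq hΩ s₁ hy).symm.trans (e₁ y hy).2
  have hd₂ := fun y hy => (det_Hess_eq hΩ s₂ hy).symm.trans (e₂ y hy).2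
  have hQ : ∀ y ∈ Ω, ∀ a b, 0 ≤ cofForm s y a b := fun y hy a b => by
    rw [hcof y hy]
    exact add_nonneg (hn₁ y hy a b) (hn₂ y hy a b)
  have heq : ∀ y ∈ Ω, pd 1 (pd 1 s) y * pd 0 (pd 0 w) y
      - 2 * (pd 0 (pd 1 s) y * pd 0 (pd 1 w) y) + pd 0 (pd 0 s) y * pd 1 (pd 1 w) y = 0 := by
    intro y hy
    simp only [hs2 _ _ y hy, hw2 _ _ y hy]
    linear_combination 2 * hd₁ y hy - 2 * hd₂ y hy
  let K : Set (En 2) := Dᶜ ∩ w ⁻¹' Set.Ici 0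
  have hK : IsClosed K :=
    ((c₁.sub c₂).sub continuousOn_const).preimage_isClosed_of_isClosed hDo.isClosed_compl
      isClosed_Ici
  have hKΩ : K ⊆ Ω := by
    rintro y ⟨hyD, hyw⟩ hycl
    have hfr : y ∈ frontier D := by
      rw [hDo.frontier_eq]
      exact ⟨hycl, hyD⟩
    have : 0 ≤ u₁ y - u₂ y - δ := hyw
    rw [b₁ y hfr, b₂ y hfr] at this
    linarith
  have hwK : ∀ y ∈ Ω, y ∉ K → w y ≤ 0 := fun y hy hyK =>
    le_of_not_ge fun h => hyK ⟨hΩD hy, h⟩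
  have hwB : ∀ y ∈ Ω, w y ≤ |M₁| + |M₂| := fun y hy => by
    have h1 := abs_le.1 (m₁ y hy)
    have h2 := abs_le.1 (m₂ y hy)
    simp only [w, v]
    linarith [le_abs_self M₁, le_abs_self M₂]
  obtain ⟨r, hr⟩ := hDb.closure.subset_closedBall 0
  set R := max r 0 + 1 with hR
  have hR1 : 1 ≤ R := by linarith [le_max_right r 0]
  have hRΩ : ∀ y, R ≤ ‖y‖ → y ∈ Ω := fun y hy hycl => by
    have := mem_closedBall_zero_iff.1 (hr hycl)
    linarith [le_max_left r 0]
  have hgrow : ∀ y, R ≤ ‖y‖ → |s y| ≤ ((1 / 2 + |d| + |M₁|) + (1 / 2 + |d| + |M₂|)) * ‖y‖ ^ 2 := by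
    intro y hy
    rw [add_mul]
    exact (abs_add_le _ _).trans (add_le_add
      (abs_le_sq_growth (hR1.trans hy) (m₁ y (hRΩ y hy)))
      (abs_le_sq_growth (hR1.trans hy) (m₂ y (hRΩ y hy))))
  have hgrad : ∀ y ∈ Ω, 0 < w y → pd 0 w y = 0 ∧ pd 1 w y = 0 := by
    intro y hy hwy
    have h0 := energy_density_eq_zero hΩ hK hKΩ hs hw hQ heq hwK (by positivity) hwB
      (one_pos.trans_le hR1) hRΩ (by positivity) hgrow hy hwy
    rw [hcof y hy] at h0
    refine eq_zero_of_cofForm_eq_zero ((hf y).trans_eq (hd₁ y hy).symm)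
      (le_antisymm ?_ (hn₁ y hy _ _))
    linarith [hn₂ y hy (pd 0 w y) (pd 1 w y)]
  let F : En 2 → ℝ := fun y => max (w y) 0 ^ 2
  have hF0 : ∀ y ∈ Ω, y ∉ K → F y = 0 := fun y hy hyK => by
    simp [F, max_eq_right (hwK y hy hyK)]
  have hF : ContDiff ℝ 1 (Ω.indicator F) := contDiff_indicator hΩ hK hKΩ
    (contDiff_max_zero_sq.comp_contDiffOn (hw.of_le (WithTop.coe_le_coe.2 le_top))) hF0
  have hconst := is_const_of_fderiv_eq_zero (hF.differentiable (by simp)) fun y =>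
    fderiv_eq_zero_of_pd fun i => by
      rw [pd_indicator i hΩ hK hKΩ hF0]
      by_cases hy : y ∈ Ω
      · rw [Set.indicator_of_mem hy]
        simp only [F]
        rw [pd_comp i (hw.differentiableAt_of_isOpen hΩ hy) (hasDerivAt_max_zero_sq (w y))]
        rcases le_or_gt (w y) 0 with h | h
        · simp [max_eq_right h]
        · have := hgrad y hy h
          fin_cases i <;> simp [this]
      · simp [hy]
  obtain ⟨p, hp⟩ := hDne
  have hFx := hconst x p
  rw [Set.indicator_of_mem hx,
    Set.indicator_of_notMem fun h : p ∈ Ω => h (subset_closure hp)] at hFx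
  have hmax : max (w x) 0 = 0 := pow_eq_zero_iff two_ne_zero |>.1 hFx
  have hwx : u₁ x - u₂ x - δ ≤ 0 := max_eq_right_iff.1 hmax
  linarith

/-- Lemma 3.2: uniqueness for the two-dimensional exterior Dirichlet problem among solutions with
the same logarithmic coefficient `d`. -/
theorem exterior_uniqueness_dim_two
    (D : Set (En 2))
    (hDo : IsOpen D) (hDb : Bornology.IsBounded D) (hDne : D.Nonempty)
    (hDsc : StrictConvex ℝ D) (hDsm : SmoothBoundary D)
    (φ : En 2 → ℝ) (hφ : ContinuousOn φ (frontier D))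
    (f : En 2 → ℝ) (hf : ∃ β : ℝ, 2 < β ∧ FA 2 f β)
    (d : ℝ) (u₁ u₂ : En 2 → ℝ)
    (h₁ : ExtU D f φ d u₁) (h₂ : ExtU D f φ d u₂) :
    ∀ x ∈ (closure D)ᶜ, u₁ x = u₂ x := by
  obtain ⟨β, -, -, ⟨m, M, hm, hmM⟩, -⟩ := hf
  have hpos : ∀ x, 0 < f x := fun x => hm.trans_le (hmM x).1
  exact fun x hx => le_antisymm (h₁.le hDo hDb hDne hpos h₂ hx) (h₂.le hDo hDb hDne hpos h₁ hx)
end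
end

section
/- Let R > 0, ε₁ ∈ (0, 2), and let h be a harmonic function on ℝ² ∖ B̄_R satisfying |h(x)| ≤ C₀ |x|^{2−ε₁} for all |x| > R. Then there exist b ∈ ℝ², constants d₁, d₂ ∈ ℝ, and a constant C such that |h(x) − b·x − d₁ log|x| − d₂| ≤ C / |x| for all |x| > 2R. -/
open Filter Bornology Matrix MeasureTheory
open scoped RealInnerProductSpace

noncomputable section

/-- The Laplacian of `h` at `x`, as the trace of the second derivative. -/
def lapl {n : ℕ} (h : En n → ℝ) (x : En n) : ℝ :=
  ∑ i : Fin n, iteratedFDeriv ℝ 2 h x ![EuclideanSpace.single i 1, EuclideanSpace.single i 1]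

open Complex Metric InnerProductSpace Topology Asymptotics

/-- A bound on the real part of a holomorphic function controls its derivative at the centre. -/
lemma norm_deriv_le_of_abs_re_le {F : ℂ → ℂ} {z : ℂ} {r M : ℝ} (hr : 0 < r) (hM : 0 < M)
    (hF : DifferentiableOn ℂ F (ball z r)) (hre : ∀ w ∈ ball z r, |(F w).re| ≤ M) :
    ‖deriv F z‖ ≤ 8 * M / r := by
  set G : ℂ → ℂ := fun w => F (z + w) - F z with hG
  have hmaps : Set.MapsTo (fun w : ℂ => z + w) (ball 0 r) (ball z r) := by
    intro w hw
    simpa using hw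
  have hGd : DifferentiableOn ℂ G (ball 0 r) :=
    (hF.comp (by fun_prop) hmaps).sub_const _
  have hGre : Set.MapsTo G (ball 0 r) {w | w.re ≤ 2 * M} := by
    intro w hw
    have h1 := abs_le.1 (hre _ (hmaps hw))
    have h2 := abs_le.1 (hre _ (mem_ball_self hr))
    simp only [hG, Set.mem_ofPred_eq, sub_re]
    linarith
  have hbound : ∀ w ∈ sphere (0 : ℂ) (r / 2), ‖G w‖ ≤ 4 * M := by
    intro w hw
    have hw' : ‖w‖ = r / 2 := by simpa using hw
    have h := borelCaratheodory_zero (z := w) (by positivity) hGd hGre hr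
      (by simp [hw', hr]) (by simp [hG])
    rw [hw'] at h
    refine h.trans_eq ?_
    field_simp
    ring
  have hcl : DiffContOnCl ℂ G (ball 0 (r / 2)) :=
    (hGd.mono (closure_ball_subset_closedBall.trans
      (closedBall_subset_ball (by linarith)))).diffContOnCl
  have h := norm_deriv_le_of_forall_mem_sphere_norm_le (by positivity) hcl hbound
  have hd : deriv G 0 = deriv F z := by
    simp [hG, deriv_sub_const, deriv_comp_const_add]
  rw [hd] at h
  refine h.trans_eq ?_
  field_simp
  ring

/-- Twice the Wirtinger derivative `∂k/∂z` of a real function on the plane. -/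
def complexPartial (k : ℂ → ℝ) (z : ℂ) : ℂ :=
  fderiv ℝ k z 1 - I * fderiv ℝ k z I

lemma fderiv_eq_re_complexPartial_mul (k : ℂ → ℝ) (z v : ℂ) :
    fderiv ℝ k z v = (complexPartial k z * v).re := by
  conv_lhs => rw [(by simp : v = v.re • (1 : ℂ) + v.im • I)]
  rw [map_add, map_smul, map_smul]
  simp [complexPartial]
  ring

/-- Interior gradient estimate for harmonic functions in the plane. -/
lemma norm_complexPartial_le {k : ℂ → ℝ} {z : ℂ} {r M : ℝ} (hr : 0 < r) (hM : 0 < M)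
    (hk : HarmonicOnNhd k (ball z r)) (hb : ∀ w ∈ ball z r, |k w| ≤ M) :
    ‖complexPartial k z‖ ≤ 8 * M / r := by
  obtain ⟨F, hF, hFk⟩ := hk.exists_analyticOnNhd_ball_re_eq
  have hz := mem_ball_self (x := z) hr
  have hd : HasDerivAt F (deriv F z) z := (hF z hz).differentiableAt.hasDerivAt
  have hkd : HasFDerivAt k
      (reCLM.comp ((ContinuousLinearMap.toSpanSingleton ℂ (deriv F z)).restrictScalars ℝ)) z :=
    (reCLM.hasFDerivAt.comp z (hd.hasFDerivAt.restrictScalars ℝ)).congr_of_eventuallyEq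
      ((hFk.eventuallyEq_of_mem (isOpen_ball.mem_nhds hz)).symm)
  have : complexPartial k z = deriv F z := by
    apply Complex.ext <;> simp [complexPartial, hkd.fderiv]
  rw [this]
  exact norm_deriv_le_of_abs_re_le hr hM hF.differentiableOn
    fun w hw => by simpa only [hFk hw] using hb w hw

/-- A function holomorphic outside a disc and `o(z)` at infinity is a constant plus a multiple of
`1/z` plus the derivative of a holomorphic function of `1/z`. -/
lemma exists_hasDerivAt_of_isLittleO_id {f : ℂ → ℂ} {R : ℝ} (hR : 0 < R)
    (hf : DifferentiableOn ℂ f {z | R < ‖z‖}) (ho : f =o[cobounded ℂ] (fun z => z)) :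
    ∃ (a c : ℂ) (P : ℂ → ℂ), P 0 = 0 ∧ DifferentiableOn ℂ P (ball 0 R⁻¹) ∧
      ∀ z, R < ‖z‖ → HasDerivAt (fun z => a * z + P z⁻¹) (f z - c / z) z := by
  have hs : ball (0 : ℂ) R⁻¹ ∈ 𝓝 0 := ball_mem_nhds _ (by positivity)
  set g : ℂ → ℂ := fun w => f w⁻¹ with hg
  have hgd : DifferentiableOn ℂ g (ball 0 R⁻¹ \ {0}) := by
    refine hf.comp (differentiableOn_inv.mono fun w hw => hw.2) ?_
    intro w hw
    have h0 : 0 < ‖w‖ := norm_pos_iff.2 hw.2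
    have h1 : ‖w‖ < R⁻¹ := by simpa using hw.1
    simpa using (lt_inv_comm₀ h0 hR).1 h1
  have hgo : (fun w => g w - g 0) =o[𝓝[≠] 0] fun w => (w - 0)⁻¹ := by
    simp only [sub_zero]
    refine (ho.comp_tendsto Filter.tendsto_inv₀_nhdsNE_zero).sub ?_
    rw [isLittleO_const_left]
    right
    exact tendsto_norm_cobounded_atTop.comp Filter.tendsto_inv₀_nhdsNE_zero
  have hφ := differentiableOn_update_limUnder_of_isLittleO hs hgd hgo
  set φ := Function.update g 0 (limUnder (𝓝[≠] 0) g) with hφdef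
  have hφ₁ := (differentiableOn_dslope hs).2 hφ
  have hφ₂ := (differentiableOn_dslope hs).2 hφ₁
  set ψ := dslope (dslope φ 0) 0 with hψ
  obtain ⟨P, hP0, hP⟩ := hφ₂.neg.isExactOn_ball.with_val_at 0 0
  refine ⟨φ 0, dslope φ 0 0, P, hP0,
    fun w hw => (hP w hw).differentiableAt.differentiableWithinAt, fun z hz => ?_⟩
  have hz0 : z ≠ 0 := norm_pos_iff.1 (hR.trans hz)
  have hzb : z⁻¹ ∈ ball (0 : ℂ) R⁻¹ := by
    simpa using (inv_lt_inv₀ (hR.trans hz) hR).2 hz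
  have e1 := sub_smul_dslope φ 0 z⁻¹
  have e2 := sub_smul_dslope (dslope φ 0) 0 z⁻¹
  have e3 : φ z⁻¹ = f z := by simp [hφdef, hg, hz0]
  rw [e3] at e1
  simp only [sub_zero, smul_eq_mul, ← hψ] at e1 e2
  refine (((hasDerivAt_id z).const_mul (φ 0)).add
    ((hP _ hzb).comp z (hasDerivAt_inv hz0))).congr_deriv ?_
  rw [eq_comm, sub_eq_iff_eq_add] at e1 e2
  simp only [Pi.neg_apply]
  rw [e1, e2]
  field_simp
  ring

/-- A function harmonic outside a disc whose gradient is `o(|z|)` is linear plus logarithmic plus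
constant up to `O(1/|z|)`. -/
lemma exists_expansion_of_isLittleO_complexPartial {k : ℂ → ℝ} {R : ℝ} (hR : 0 < R)
    (hk : HarmonicOnNhd k {z | R < ‖z‖}) (ho : complexPartial k =o[cobounded ℂ] (fun z => z)) :
    ∃ (a : ℂ) (d₁ d₂ C : ℝ), ∀ z : ℂ, 2 * R < ‖z‖ →
      |k z - (a * z).re - d₁ * Real.log ‖z‖ - d₂| ≤ C / ‖z‖ := by
  have hf : DifferentiableOn ℂ (complexPartial k) {z | R < ‖z‖} := fun z hz =>
    (HarmonicAt.analyticAt_complex_partial (hk z hz)).differentiableAt.differentiableWithinAt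
  obtain ⟨a, c, P, hP0, hPd, hP⟩ := exists_hasDerivAt_of_isLittleO_id hR hf ho
  set U : Set ℂ := {ζ | Real.log R < ζ.re} with hU
  have hUexp : ∀ ζ ∈ U, R < ‖exp ζ‖ := fun ζ hζ => by
    rw [norm_exp]
    exact (Real.log_lt_iff_lt_exp hR).1 hζ
  set u : ℂ → ℝ := fun ζ => k (exp ζ) - (a * exp ζ + P (exp ζ)⁻¹ + c * ζ).re with hu
  have hud : ∀ ζ ∈ U, HasFDerivAt u (0 : ℂ →L[ℝ] ℝ) ζ := by
    intro ζ hζ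
    have h1 : HasFDerivAt (fun ζ => k (exp ζ)) _ ζ :=
      ((hk _ (hUexp ζ hζ)).1.differentiableAt two_ne_zero).hasFDerivAt.comp ζ
        ((hasDerivAt_exp ζ).hasFDerivAt.restrictScalars ℝ)
    have h2 : HasDerivAt (fun ζ => a * exp ζ + P (exp ζ)⁻¹ + c * ζ) _ ζ :=
      ((hP _ (hUexp ζ hζ)).comp ζ (hasDerivAt_exp ζ)).add ((hasDerivAt_id ζ).const_mul c)
    have h3 := h1.sub (reCLM.hasFDerivAt.comp ζ (h2.hasFDerivAt.restrictScalars ℝ))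
    refine h3.congr_fderiv ?_
    ext v
    have : (complexPartial k (exp ζ) - c / exp ζ) * exp ζ + c * 1
        = complexPartial k (exp ζ) * exp ζ := by
      field_simp [exp_ne_zero ζ]
      ring
    simp only [this, _root_.sub_apply, ContinuousLinearMap.comp_apply,
      fderiv_eq_re_complexPartial_mul, ContinuousLinearMap.coe_restrictScalars',
      ContinuousLinearMap.toSpanSingleton_apply, reCLM_apply, smul_eq_mul,
      _root_.zero_apply]
    rw [mul_left_comm v, mul_comm v, sub_self]
  have hUo : IsOpen U := isOpen_lt continuous_const continuous_re
  obtain ⟨d₂, hd₂⟩ := hUo.exists_is_const_of_fderiv_eq_zero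
    (convex_halfSpace_re_gt _).isPreconnected
    (fun ζ hζ => (hud ζ hζ).differentiableAt.differentiableWithinAt)
    (fun ζ hζ => (hud ζ hζ).fderiv)
  have hc : c.im = 0 := by
    have hζ : ((Real.log R + 1 : ℝ) : ℂ) ∈ U := by simp [hU]
    have hζ' : ((Real.log R + 1 : ℝ) : ℂ) + 2 * Real.pi * I ∈ U := by simp [hU]
    have h := (hd₂ _ hζ').trans (hd₂ _ hζ).symm
    simp only [hu, exp_periodic _] at h
    simpa [Real.pi_ne_zero] using h
  have hPs := (differentiableOn_dslope (ball_mem_nhds (0 : ℂ) (inv_pos.2 hR))).2 hPd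
  have hsub : closedBall (0 : ℂ) (2 * R)⁻¹ ⊆ ball 0 R⁻¹ :=
    closedBall_subset_ball ((inv_lt_inv₀ (by positivity) hR).2 (by linarith))
  obtain ⟨C, hC⟩ := (isCompact_closedBall (0 : ℂ) (2 * R)⁻¹).exists_bound_of_continuousOn
    (hPs.continuousOn.mono hsub)
  refine ⟨a, c.re, d₂, C, fun z hz => ?_⟩
  have hzpos : 0 < ‖z‖ := by linarith
  have hz0 : z ≠ 0 := norm_pos_iff.1 hzpos
  have hlog : log z ∈ U := by
    simpa [hU, log_re] using Real.log_lt_log hR (by linarith)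
  have h := hd₂ _ hlog
  simp only [hu, exp_log hz0, add_re, mul_re c, hc, log_re, zero_mul, sub_zero] at h
  have hPz : k z - (a * z).re - c.re * Real.log ‖z‖ - d₂ = (P z⁻¹).re := by linarith
  rw [hPz]
  have hPz' : P z⁻¹ = z⁻¹ * dslope P 0 z⁻¹ := by
    simpa [hP0] using (sub_smul_dslope P 0 z⁻¹).symm
  have hmem : z⁻¹ ∈ closedBall (0 : ℂ) (2 * R)⁻¹ := by
    rw [mem_closedBall_zero_iff, norm_inv]
    exact inv_anti₀ (by positivity) hz.le
  calc |(P z⁻¹).re| ≤ ‖P z⁻¹‖ := abs_re_le_norm _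
    _ = ‖dslope P 0 z⁻¹‖ / ‖z‖ := by rw [hPz', norm_mul, norm_inv]; field_simp
    _ ≤ C / ‖z‖ := by gcongr; exact hC _ hmem

/-- The gradient of a subquadratic harmonic function on an exterior domain is `o(|z|)`. -/
lemma isLittleO_complexPartial_of_abs_le_rpow {k : ℂ → ℝ} {R ε C₀ : ℝ} (hR : 0 < R)
    (hε : 0 < ε) (hε' : ε < 2) (hk : HarmonicOnNhd k {z | R < ‖z‖})
    (hb : ∀ z, R < ‖z‖ → |k z| ≤ C₀ * ‖z‖ ^ (2 - ε)) :
    complexPartial k =o[cobounded ℂ] (fun z => z) := by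
  have hO : complexPartial k =O[cobounded ℂ] fun z => ‖z‖ ^ (1 - ε) := by
    refine IsBigO.of_bound (16 * (|C₀| + 1) * 2 ^ (2 - ε)) ?_
    filter_upwards [tendsto_norm_cobounded_atTop.eventually_gt_atTop (2 * R)] with z hz
    have hzpos : 0 < ‖z‖ := by linarith
    have hball : ∀ w ∈ ball z (‖z‖ / 2), R < ‖w‖ ∧ ‖w‖ ≤ 2 * ‖z‖ := by
      intro w hw
      have h1 : ‖w - z‖ < ‖z‖ / 2 := by simpa [dist_eq_norm] using hw
      have h2 := norm_sub_norm_le z w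
      have h3 := norm_sub_norm_le w z
      rw [norm_sub_rev] at h2
      constructor <;> linarith
    have h := norm_complexPartial_le (M := (|C₀| + 1) * (2 * ‖z‖) ^ (2 - ε)) (half_pos hzpos)
      (by positivity) (hk.mono fun w hw => (hball w hw).1) (fun w hw => by
        refine (hb w (hball w hw).1).trans ?_
        have : C₀ ≤ |C₀| + 1 := (le_abs_self _).trans (by linarith)
        have h2 : 0 ≤ 2 - ε := by linarith
        gcongr
        exact (hball w hw).2)
    refine h.trans_eq ?_
    rw [Real.norm_of_nonneg (by positivity), Real.mul_rpow (by norm_num) hzpos.le,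
      show (2 : ℝ) - ε = 1 - ε + 1 by ring, Real.rpow_add_one hzpos.ne']
    field_simp
    ring
  refine hO.trans_isLittleO (isLittleO_norm_right.1 ?_)
  refine isLittleO_of_tendsto' ?_ ?_
  · filter_upwards [tendsto_norm_cobounded_atTop.eventually_gt_atTop 0] with z hz h0
    exact absurd h0 hz.ne'
  · refine ((tendsto_rpow_neg_atTop hε).comp tendsto_norm_cobounded_atTop).congr' ?_
    filter_upwards [tendsto_norm_cobounded_atTop.eventually_gt_atTop 0] with z hz
    rw [Function.comp_apply, ← Real.rpow_sub_one hz.ne']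
    ring_nf

lemma harmonicOnNhd_comp_repr {h : En 2 → ℝ} {R : ℝ}
    (hC2 : ContDiffOn ℝ 2 h {x : En 2 | R < ‖x‖})
    (hharm : ∀ x : En 2, R < ‖x‖ → lapl h x = 0) :
    HarmonicOnNhd (h ∘ orthonormalBasisOneI.repr) {z | R < ‖z‖} := by
  have hopen : IsOpen {x : En 2 | R < ‖x‖} := isOpen_lt continuous_const continuous_norm
  have hopen' : IsOpen {z : ℂ | R < ‖z‖} := isOpen_lt continuous_const continuous_norm
  have key : ∀ z : ℂ, R < ‖z‖ → ContDiffAt ℝ 2 h (orthonormalBasisOneI.repr z) := fun z hz =>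
    hC2.contDiffAt (hopen.mem_nhds (by simpa using hz))
  intro z hz
  refine ⟨(key z hz).comp z orthonormalBasisOneI.repr.contDiff.contDiffAt, ?_⟩
  filter_upwards [hopen'.mem_nhds hz] with w hw
  have hl := hharm (orthonormalBasisOneI.repr w) (by simpa using hw)
  have hcomp : iteratedFDeriv ℝ 2 (h ∘ orthonormalBasisOneI.repr) w =
      (iteratedFDeriv ℝ 2 h (orthonormalBasisOneI.repr w)).compContinuousLinearMap
        fun _ => (orthonormalBasisOneI.repr.toContinuousLinearEquiv : ℂ →L[ℝ] En 2) := by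
    have := orthonormalBasisOneI.repr.toContinuousLinearEquiv.iteratedFDerivWithin_comp_right
      h uniqueDiffOn_univ (Set.mem_univ (orthonormalBasisOneI.repr w)) 2
    simpa [iteratedFDerivWithin_univ] using this
  have h1 : orthonormalBasisOneI.repr 1 = EuclideanSpace.single 0 1 := by
    simpa using orthonormalBasisOneI.repr_self 0
  have hI : orthonormalBasisOneI.repr I = EuclideanSpace.single 1 1 := by
    simpa using orthonormalBasisOneI.repr_self 1
  rw [laplacian_eq_iteratedFDeriv_complexPlane]
  simp only [hcomp, ContinuousMultilinearMap.compContinuousLinearMap_apply, Pi.zero_apply]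
  rw [lapl, Fin.sum_univ_two] at hl
  rw [← hl]
  congr 2 <;> (ext i; fin_cases i <;> simp [h1, hI])

/-- Equation (12mar8e1): a harmonic function on the exterior of a disc growing slower than
quadratically is a linear function plus a logarithm plus a constant, up to `O(1/|x|)`. -/
theorem harmonic_expansion_dim_two
    (R ε₁ C₀ : ℝ) (hR : 0 < R) (hε₁ : 0 < ε₁) (hε₁' : ε₁ < 2)
    (h : En 2 → ℝ)
    (hC2 : ContDiffOn ℝ 2 h {x : En 2 | R < ‖x‖})
    (hharm : ∀ x : En 2, R < ‖x‖ → lapl h x = 0)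
    (hbd : ∀ x : En 2, R < ‖x‖ → |h x| ≤ C₀ * ‖x‖ ^ ((2 : ℝ) - ε₁)) :
    ∃ (b : En 2) (d₁ d₂ C : ℝ), ∀ x : En 2, 2 * R < ‖x‖ →
      |h x - ⟪b, x⟫ - d₁ * Real.log ‖x‖ - d₂| ≤ C / ‖x‖ := by
  have hk := harmonicOnNhd_comp_repr hC2 hharm
  obtain ⟨a, d₁, d₂, C, H⟩ := exists_expansion_of_isLittleO_complexPartial hR hk
    (isLittleO_complexPartial_of_abs_le_rpow hR hε₁ hε₁' hk fun z hz => by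
      simpa using hbd (orthonormalBasisOneI.repr z) (by simpa using hz))
  refine ⟨!₂[a.re, -a.im], d₁, d₂, C, fun x hx => ?_⟩
  have hx' := H (orthonormalBasisOneI.repr.symm x) (by rwa [LinearIsometryEquiv.norm_map])
  have hinner : (a * orthonormalBasisOneI.repr.symm x).re = ⟪!₂[a.re, -a.im], x⟫ := by
    simp [PiLp.inner_apply, Fin.sum_univ_two]
    ring
  rwa [LinearIsometryEquiv.norm_map, hinner, Function.comp_apply,
    LinearIsometryEquiv.apply_symm_apply] at hx'
end
end

section
/- Let n ≥ 3, R₁ > 0, 0 < 2ε < 1 and C₀ > 0. Let f₂ be a continuous function on ℝⁿ ∖ B_{R₁} with |f₂(y)| ≤ C₀ |y|^{−2−2ε} for all |y| > R₁, and define h₂(x) = − (1/(n(n−2)ω_n)) ∫_{ℝⁿ ∖ B_{R₁}} |x−y|^{2−n} f₂(y) dy, where ω_n is the volume of the unit ball in ℝⁿ. Then the integral converges for every x, h₂ is C¹ on ℝⁿ ∖ B̄_{2R₁}, and there is a constant C depending only on n, R₁, ε, C₀ such that |h₂(x)| ≤ C|x|^{−2ε} and |Dh₂(x)| ≤ C|x|^{−2ε−1}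 for all |x| > 2R₁. If n = 2, the same conclusion holds with h₂(x) = (1/(2π)) ∫_{ℝ² ∖ B_{R₁}} (log|x−y| − log|x|) f₂(y) dy and with the decay rates |x|^{−ε̄} and |x|^{−ε̄−1} for any fixed ε̄ ∈ (0, 2ε). -/
open Filter Bornology Matrix MeasureTheory
open scoped RealInnerProductSpace

noncomputable section

/-- The Newtonian potential of `f₂` over the exterior region `{|y| ≥ R₁}`, for `n ≥ 3`. -/
def newtonPot (n : ℕ) (R₁ : ℝ) (f₂ : En n → ℝ) (x : En n) : ℝ :=
  -(1 / ((n : ℝ) * ((n : ℝ) - 2) * (volume (Metric.ball (0 : En n) 1)).toReal)) *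
    ∫ y in {y : En n | R₁ ≤ ‖y‖}, ‖x - y‖ ^ ((2 : ℝ) - (n : ℝ)) * f₂ y

/-- The logarithmic potential of `f₂` over the exterior region `{|y| ≥ R₁}`, for `n = 2`. -/
def logPot (n : ℕ) (R₁ : ℝ) (f₂ : En n → ℝ) (x : En n) : ℝ :=
  (1 / (2 * Real.pi)) *
    ∫ y in {y : En n | R₁ ≤ ‖y‖}, (Real.log ‖x - y‖ - Real.log ‖x‖) * f₂ y

open scoped Topology

/-- In polar coordinates, the pointwise Jacobian identity for a truncated power. -/
lemma pow_smul_indicator_rpow {n : ℕ} (hn : 1 ≤ n) (a : ℝ) (A : Set ℝ) {r : ℝ} (hr : 0 < r) :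
    r ^ (n - 1) • A.indicator (fun s : ℝ => s ^ (-a)) r
      = A.indicator (fun s : ℝ => s ^ ((n : ℝ) - 1 - a)) r := by
  by_cases h : r ∈ A
  · simp only [Set.indicator_of_mem h, smul_eq_mul]
    rw [← Real.rpow_natCast, ← Real.rpow_add hr, Nat.cast_sub hn]
    congr 1
    push_cast
    ring
  · simp [h]

lemma integrable_indicator_norm_rpow {n : ℕ} (hn : 1 ≤ n) {a : ℝ} {A : Set ℝ}
    (hA : MeasurableSet A)
    (h : IntegrableOn (fun r : ℝ => r ^ ((n : ℝ) - 1 - a)) (A ∩ Set.Ioi 0)) :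
    Integrable (fun z : En n => A.indicator (fun r : ℝ => r ^ (-a)) ‖z‖) := by
  have : Nontrivial (En n) := by
    have : Nonempty (Fin n) := ⟨⟨0, hn⟩⟩
    infer_instance
  rw [integrable_fun_norm_addHaar volume (f := A.indicator (fun r : ℝ => r ^ (-a)))]
  rw [integrableOn_congr_fun (g := A.indicator (fun r : ℝ => r ^ ((n : ℝ) - 1 - a))) _
    measurableSet_Ioi]
  · rw [IntegrableOn, integrable_indicator_iff hA, IntegrableOn, Measure.restrict_restrict hA]
    exact h
  · intro r hr
    simpa using pow_smul_indicator_rpow hn a A hr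

lemma integral_indicator_norm_rpow {n : ℕ} (hn : 1 ≤ n) (a : ℝ) {A : Set ℝ}
    (hA : MeasurableSet A) :
    ∫ z : En n, A.indicator (fun r : ℝ => r ^ (-a)) ‖z‖
      = n * volume.real (Metric.ball (0 : En n) 1) *
        ∫ r in A ∩ Set.Ioi 0, r ^ ((n : ℝ) - 1 - a) := by
  have : Nontrivial (En n) := by
    have : Nonempty (Fin n) := ⟨⟨0, hn⟩⟩
    infer_instance
  rw [integral_fun_norm_addHaar volume (A.indicator (fun r : ℝ => r ^ (-a)))]
  rw [setIntegral_congr_fun (g := A.indicator (fun r : ℝ => r ^ ((n : ℝ) - 1 - a)))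
    measurableSet_Ioi]
  · rw [integral_indicator hA, Measure.restrict_restrict hA]
    simp [mul_assoc]
  · intro r hr
    simpa using pow_smul_indicator_rpow hn a A hr

/-- Integrals of negative powers of the norm over balls centred at the origin. -/
lemma exists_integral_norm_rpow_Iic_le {n : ℕ} (hn : 1 ≤ n) {a : ℝ} (ha : a < n) :
    ∃ C > 0, ∀ ρ > 0,
      Integrable (fun z : En n => (Set.Iic ρ).indicator (fun r : ℝ => r ^ (-a)) ‖z‖) ∧
      ∫ z : En n, (Set.Iic ρ).indicator (fun r : ℝ => r ^ (-a)) ‖z‖ ≤ C * ρ ^ (n - a) := by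
  refine ⟨(n * volume.real (Metric.ball (0 : En n) 1) + 1) / (n - a),
    div_pos (by positivity) (by linarith), fun ρ hρ => ?_⟩
  have hset : Set.Iic ρ ∩ Set.Ioi 0 = Set.Ioc 0 ρ := by
    rw [Set.inter_comm]; exact Set.Ioi_inter_Iic
  constructor
  · apply integrable_indicator_norm_rpow hn measurableSet_Iic
    rw [hset, ← intervalIntegrable_iff_integrableOn_Ioc_of_le hρ.le]
    exact intervalIntegral.intervalIntegrable_rpow' (by linarith)
  · rw [integral_indicator_norm_rpow hn a measurableSet_Iic, hset,
      ← intervalIntegral.integral_of_le hρ.le, integral_rpow (Or.inl (by linarith)),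
      show (n : ℝ) - 1 - a + 1 = n - a by ring, Real.zero_rpow (by linarith), sub_zero,
      div_mul_eq_mul_div, ← mul_div_assoc]
    have : 0 ≤ ρ ^ ((n : ℝ) - a) := by positivity
    have : 0 < (n : ℝ) - a := by linarith
    gcongr
    linarith

/-- Integrals of negative powers of the norm over complements of balls centred at the origin. -/
lemma exists_integral_norm_rpow_Ioi_le {n : ℕ} (hn : 1 ≤ n) {a : ℝ} (ha : n < a) :
    ∃ C > 0, ∀ ρ > 0,
      Integrable (fun z : En n => (Set.Ioi ρ).indicator (fun r : ℝ => r ^ (-a)) ‖z‖) ∧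
      ∫ z : En n, (Set.Ioi ρ).indicator (fun r : ℝ => r ^ (-a)) ‖z‖ ≤ C * ρ ^ (n - a) := by
  refine ⟨(n * volume.real (Metric.ball (0 : En n) 1) + 1) / (a - n),
    div_pos (by positivity) (by linarith), fun ρ hρ => ?_⟩
  have hset : Set.Ioi ρ ∩ Set.Ioi 0 = Set.Ioi ρ := by
    rw [Set.Ioi_inter_Ioi, sup_of_le_left hρ.le]
  constructor
  · apply integrable_indicator_norm_rpow hn measurableSet_Ioi
    rw [hset]
    exact integrableOn_Ioi_rpow_of_lt (by linarith) hρ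
  · rw [integral_indicator_norm_rpow hn a measurableSet_Ioi, hset,
      integral_Ioi_rpow_of_lt (by linarith) hρ,
      show (n : ℝ) - 1 - a + 1 = n - a by ring, ← neg_div_neg_eq, neg_neg, neg_sub,
      div_mul_eq_mul_div, ← mul_div_assoc]
    have : 0 ≤ ρ ^ ((n : ℝ) - a) := by positivity
    have : 0 < a - n := by linarith
    gcongr
    linarith

lemma indicator_rpow_nonneg (a : ℝ) (A : Set ℝ) {r : ℝ} (hr : 0 ≤ r) :
    0 ≤ A.indicator (fun s : ℝ => s ^ a) r := by
  by_cases h : r ∈ A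
  · simp only [Set.indicator_of_mem h]; positivity
  · simp [h]

/-- Splitting into the regions near the origin, near `x`, and the rest. -/
lemma norm_rpow_mul_norm_rpow_le {n : ℕ} {a b : ℝ} (ha : 0 ≤ a) (hb : 0 ≤ b) {x : En n}
    (hx : x ≠ 0) (y : En n) :
    ‖x - y‖ ^ (-a) * ‖y‖ ^ (-b) ≤
      (‖x‖ / 2) ^ (-a) * (Set.Iic (‖x‖ / 2)).indicator (fun r : ℝ => r ^ (-b)) ‖y‖
      + (‖x‖ / 2) ^ (-b) * (Set.Iic (‖x‖ / 2)).indicator (fun r : ℝ => r ^ (-a)) ‖x - y‖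
      + 3 ^ a * (Set.Ioi (‖x‖ / 2)).indicator (fun r : ℝ => r ^ (-(a + b))) ‖y‖ := by
  have hρ : 0 < ‖x‖ / 2 := by positivity
  have htri : ‖x‖ ≤ ‖x - y‖ + ‖y‖ := by simpa using norm_add_le (x - y) y
  have htri' : ‖y‖ ≤ ‖x - y‖ + ‖x‖ := by
    simpa [norm_sub_rev] using norm_add_le (y - x) x
  have h1 : 0 ≤ (‖x‖ / 2) ^ (-a) *
      (Set.Iic (‖x‖ / 2)).indicator (fun r : ℝ => r ^ (-b)) ‖y‖ :=
    mul_nonneg (by positivity) (indicator_rpow_nonneg _ _ (norm_nonneg _))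
  have h2 : 0 ≤ (‖x‖ / 2) ^ (-b) *
      (Set.Iic (‖x‖ / 2)).indicator (fun r : ℝ => r ^ (-a)) ‖x - y‖ :=
    mul_nonneg (by positivity) (indicator_rpow_nonneg _ _ (norm_nonneg _))
  have h3 : 0 ≤ (3 : ℝ) ^ a *
      (Set.Ioi (‖x‖ / 2)).indicator (fun r : ℝ => r ^ (-(a + b))) ‖y‖ :=
    mul_nonneg (by positivity) (indicator_rpow_nonneg _ _ (norm_nonneg _))
  rcases le_or_gt ‖y‖ (‖x‖ / 2) with hy | hy
  · have : ‖x - y‖ ^ (-a) ≤ (‖x‖ / 2) ^ (-a) :=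
      Real.rpow_le_rpow_of_nonpos hρ (by linarith) (by linarith)
    rw [Set.indicator_of_mem (Set.mem_Iic.2 hy)] at h1 ⊢
    have := mul_le_mul_of_nonneg_right this (Real.rpow_nonneg (norm_nonneg y) (-b))
    linarith
  · rcases le_or_gt ‖x - y‖ (‖x‖ / 2) with hxy | hxy
    · have : ‖y‖ ^ (-b) ≤ (‖x‖ / 2) ^ (-b) :=
        Real.rpow_le_rpow_of_nonpos hρ (by linarith) (by linarith)
      rw [Set.indicator_of_mem (Set.mem_Iic.2 hxy)] at h2 ⊢
      have := mul_le_mul_of_nonneg_right this (Real.rpow_nonneg (norm_nonneg (x - y)) (-a))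
      linarith
    · have hy0 : 0 < ‖y‖ := hρ.trans hy
      have : ‖x - y‖ ^ (-a) ≤ (‖y‖ / 3) ^ (-a) :=
        Real.rpow_le_rpow_of_nonpos (by positivity) (by linarith) (by linarith)
      have h3a : (‖y‖ / 3) ^ (-a) * ‖y‖ ^ (-b) = 3 ^ a * ‖y‖ ^ (-(a + b)) := by
        rw [Real.div_rpow hy0.le (by norm_num), Real.rpow_neg (by norm_num : (0 : ℝ) ≤ 3),
          div_inv_eq_mul, neg_add, Real.rpow_add hy0]
        ring
      rw [Set.indicator_of_mem (Set.mem_Ioi.2 hy)] at h3 ⊢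
      have := mul_le_mul_of_nonneg_right this (Real.rpow_nonneg (norm_nonneg y) (-b))
      linarith

/-- Convolution of two negative powers of the norm. -/
lemma exists_integral_norm_rpow_mul_norm_rpow_le {n : ℕ} (hn : 1 ≤ n) {a b : ℝ} (ha : 0 ≤ a)
    (hb : 0 ≤ b) (han : a < n) (hbn : b < n) (hab : n < a + b) :
    ∃ C > 0, ∀ x : En n, x ≠ 0 →
      Integrable (fun y : En n => ‖x - y‖ ^ (-a) * ‖y‖ ^ (-b)) ∧
      ∫ y : En n, ‖x - y‖ ^ (-a) * ‖y‖ ^ (-b) ≤ C * ‖x‖ ^ (n - a - b) := by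
  obtain ⟨C₁, hC₁, H₁⟩ := exists_integral_norm_rpow_Iic_le hn hbn
  obtain ⟨C₂, hC₂, H₂⟩ := exists_integral_norm_rpow_Iic_le hn han
  obtain ⟨C₃, hC₃, H₃⟩ := exists_integral_norm_rpow_Ioi_le hn hab
  refine ⟨(C₁ + C₂ + 3 ^ a * C₃) * 2 ^ (a + b - n), by positivity, fun x hx => ?_⟩
  have hρ : 0 < ‖x‖ / 2 := by positivity
  obtain ⟨I₁, J₁⟩ := H₁ _ hρ
  obtain ⟨I₂, J₂⟩ := H₂ _ hρ
  obtain ⟨I₃, J₃⟩ := H₃ _ hρ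
  have I₂' := I₂.comp_sub_left x
  have hI := ((I₁.const_mul ((‖x‖ / 2) ^ (-a))).add (I₂'.const_mul ((‖x‖ / 2) ^ (-b)))).add
    (I₃.const_mul (3 ^ a))
  have hle := norm_rpow_mul_norm_rpow_le ha hb hx
  have hint : Integrable (fun y : En n => ‖x - y‖ ^ (-a) * ‖y‖ ^ (-b)) := by
    refine hI.mono' (Measurable.aestronglyMeasurable (by fun_prop)) (ae_of_all _ fun y => ?_)
    rw [Real.norm_of_nonneg (by positivity)]
    exact hle y
  refine ⟨hint, (integral_mono hint hI hle).trans ?_⟩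
  have e₁ : (‖x‖ / 2) ^ (-a) * (‖x‖ / 2) ^ ((n : ℝ) - b) = (‖x‖ / 2) ^ ((n : ℝ) - a - b) := by
    rw [← Real.rpow_add hρ]; ring_nf
  have e₂ : (‖x‖ / 2) ^ (-b) * (‖x‖ / 2) ^ ((n : ℝ) - a) = (‖x‖ / 2) ^ ((n : ℝ) - a - b) := by
    rw [← Real.rpow_add hρ]; ring_nf
  have e₃ : ‖x‖ ^ ((n : ℝ) - a - b) * 2 ^ (a + b - n) = (‖x‖ / 2) ^ ((n : ℝ) - a - b) := by
    rw [Real.div_rpow (norm_nonneg x) (by norm_num), div_eq_mul_inv,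
      ← Real.rpow_neg (by norm_num)]
    ring_nf
  simp only [Pi.add_apply]
  rw [integral_add (by exact (I₁.const_mul _).add (I₂'.const_mul _)) (I₃.const_mul _),
    integral_add (I₁.const_mul _) (I₂'.const_mul _), integral_const_mul, integral_const_mul,
    integral_const_mul, integral_sub_left_eq_self
      (fun z => (Set.Iic (‖x‖ / 2)).indicator (fun r : ℝ => r ^ (-a)) ‖z‖) volume x]
  have k₁ := mul_le_mul_of_nonneg_left J₁ (by positivity : 0 ≤ (‖x‖ / 2) ^ (-a))
  have k₂ := mul_le_mul_of_nonneg_left J₂ (by positivity : 0 ≤ (‖x‖ / 2) ^ (-b))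
  have k₃ := mul_le_mul_of_nonneg_left J₃ (by positivity : (0 : ℝ) ≤ 3 ^ a)
  calc _ ≤ _ := add_le_add (add_le_add k₁ k₂) k₃
    _ = C₁ * ((‖x‖ / 2) ^ (-a) * (‖x‖ / 2) ^ ((n : ℝ) - b))
        + C₂ * ((‖x‖ / 2) ^ (-b) * (‖x‖ / 2) ^ ((n : ℝ) - a))
        + 3 ^ a * C₃ * (‖x‖ / 2) ^ ((n : ℝ) - a - b) := by rw [sub_sub]; ring
    _ = _ := by rw [e₁, e₂, ← e₃]; ring

/-- A power singularity at the origin, with decay at infinity supplied by a Japanese bracket. -/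
lemma integrable_norm_rpow_mul_one_add_norm_rpow {n : ℕ} (hn : 1 ≤ n) {a b : ℝ}
    (han : a < n) (hab : n < a + b) :
    Integrable (fun z : En n => ‖z‖ ^ (-a) * (1 + ‖z‖) ^ (-b)) := by
  obtain ⟨C₂, hC₂, H₂⟩ := exists_integral_norm_rpow_Iic_le hn han
  obtain ⟨C₃, hC₃, H₃⟩ := exists_integral_norm_rpow_Ioi_le hn hab
  refine ((H₂ 1 one_pos).1.add (H₃ 1 one_pos).1).mono'
    (Measurable.aestronglyMeasurable (by fun_prop)) (ae_of_all _ fun z => ?_)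
  rw [Real.norm_of_nonneg (by positivity), Pi.add_apply]
  rcases le_or_gt ‖z‖ 1 with hz | hz
  · rw [Set.indicator_of_mem (Set.mem_Iic.2 hz), Set.indicator_of_notMem (by simpa using hz),
      add_zero]
    exact mul_le_of_le_one_right (by positivity)
      (Real.rpow_le_one_of_one_le_of_nonpos (by simp) (by linarith))
  · rw [Set.indicator_of_mem (Set.mem_Ioi.2 hz), Set.indicator_of_notMem (by simpa using hz),
      zero_add, neg_add, Real.rpow_add (by linarith)]
    exact mul_le_mul_of_nonneg_left
      (Real.rpow_le_rpow_of_nonpos (by linarith) (by linarith) (by linarith)) (by positivity)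

/-- The gradient of the radial function `k ‖z‖` when `k' r = c * r ^ (1 - n)`. -/
def radialGrad {n : ℕ} (c : ℝ) (z : En n) : En n →L[ℝ] ℝ :=
  (c * ‖z‖ ^ (-(n : ℝ))) • innerSL ℝ z

lemma radialGrad_apply {n : ℕ} (c : ℝ) (z v : En n) :
    radialGrad c z v = c * ‖z‖ ^ (-(n : ℝ)) * ⟪z, v⟫ := rfl

lemma measurable_radialGrad {n : ℕ} (c : ℝ) : Measurable (radialGrad (n := n) c) := by
  have h1 : Measurable (fun z : En n => c * ‖z‖ ^ (-(n : ℝ))) := by fun_prop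
  have h2 : Measurable (fun z : En n => innerSL ℝ z) := (innerSL ℝ).continuous.measurable
  exact h1.smul h2

lemma norm_radialGrad {n : ℕ} (hn : 2 ≤ n) (c : ℝ) (z : En n) :
    ‖radialGrad c z‖ = |c| * ‖z‖ ^ (-((n : ℝ) - 1)) := by
  have hn' : (2 : ℝ) ≤ n := by exact_mod_cast hn
  rw [radialGrad, norm_smul, innerSL_apply_norm, norm_mul, Real.norm_eq_abs c,
    Real.norm_of_nonneg (by positivity), mul_assoc]
  rcases eq_or_ne z 0 with rfl | hz
  · rw [norm_zero, mul_zero, Real.zero_rpow (by linarith)]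
  · rw [← Real.rpow_add_one (by simpa using hz)]
    ring_nf

lemma hasFDerivAt_radial {n : ℕ} {k : ℝ → ℝ} {c : ℝ}
    (hk : ∀ r > 0, HasDerivAt k (c * r ^ (-((n : ℝ) - 1))) r) {z : En n} (hz : z ≠ 0) :
    HasFDerivAt (fun z : En n => k ‖z‖) (radialGrad c z) z := by
  have hz' : 0 < ‖z‖ := norm_pos_iff.2 hz
  have h1 : HasFDerivAt (fun z : En n => ‖z‖) (‖z‖⁻¹ • innerSL ℝ z) z := by
    have := (hasStrictFDerivAt_norm_sq z).hasFDerivAt.sqrt (by positivity)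
    simp only [Real.sqrt_sq (norm_nonneg _)] at this
    refine this.congr_fderiv (ContinuousLinearMap.ext fun v => ?_)
    simp only [_root_.smul_apply, smul_eq_mul, nsmul_eq_mul]
    field_simp
    simp
  refine ((hk _ hz').comp_hasFDerivAt z h1).congr_fderiv ?_
  rw [radialGrad, smul_smul, mul_assoc, ← Real.rpow_neg_one ‖z‖, ← Real.rpow_add hz']
  ring_nf

lemma abs_sub_le_of_hasDerivAt {n : ℕ} (hn : 2 ≤ n) {k : ℝ → ℝ} {c : ℝ}
    (hk : ∀ r > 0, HasDerivAt k (c * r ^ (-((n : ℝ) - 1))) r) {r s : ℝ} (hr : 0 < r)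
    (hs : 0 < s) :
    |k s - k r| ≤ |c| * (s ^ (-((n : ℝ) - 1)) + r ^ (-((n : ℝ) - 1))) * |s - r| := by
  have hn' : (2 : ℝ) ≤ n := by exact_mod_cast hn
  wlog hrs : r ≤ s generalizing r s
  · rw [abs_sub_comm, abs_sub_comm s r, add_comm]
    exact this hs hr (by linarith)
  have hb : ∀ t ∈ Set.Icc r s, ‖c * t ^ (-((n : ℝ) - 1))‖ ≤ |c| * r ^ (-((n : ℝ) - 1)) := by
    intro t ht
    have ht0 : 0 < t := hr.trans_le ht.1
    rw [norm_mul, Real.norm_eq_abs, Real.norm_of_nonneg (by positivity)]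
    exact mul_le_mul_of_nonneg_left
      (Real.rpow_le_rpow_of_nonpos hr ht.1 (by linarith)) (abs_nonneg c)
  have := Convex.norm_image_sub_le_of_norm_hasDerivWithin_le
    (fun t ht => (hk t (hr.trans_le ht.1)).hasDerivWithinAt) hb (convex_Icc r s)
    (Set.left_mem_Icc.2 hrs) (Set.right_mem_Icc.2 hrs)
  rw [Real.norm_eq_abs, Real.norm_eq_abs] at this
  refine this.trans ?_
  gcongr
  simpa using (Real.rpow_nonneg hs.le _)

/-- First-order Taylor remainder of a radial kernel, bounded by its gradients. -/
lemma abs_radial_remainder_le {n : ℕ} (hn : 2 ≤ n) {k : ℝ → ℝ} {c : ℝ}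
    (hk : ∀ r > 0, HasDerivAt k (c * r ^ (-((n : ℝ) - 1))) r) {z v : En n} (hz : z ≠ 0)
    (hzv : z + v ≠ 0) :
    |k ‖z + v‖ - k ‖z‖ - radialGrad c z v| ≤
      2 * |c| * (‖z + v‖ ^ (-((n : ℝ) - 1)) + ‖z‖ ^ (-((n : ℝ) - 1))) * ‖v‖ := by
  have h1 := abs_sub_le_of_hasDerivAt hn hk (norm_pos_iff.2 hz) (norm_pos_iff.2 hzv)
  have h2 : |‖z + v‖ - ‖z‖| ≤ ‖v‖ := by simpa using abs_norm_sub_norm_le (z + v) z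
  have h3 : |radialGrad c z v| ≤ |c| * ‖z‖ ^ (-((n : ℝ) - 1)) * ‖v‖ := by
    rw [← norm_radialGrad hn]; exact (radialGrad c z).le_opNorm v
  have h4 : 0 ≤ |c| * ‖z + v‖ ^ (-((n : ℝ) - 1)) * ‖v‖ := by positivity
  have h5 : |c| * (‖z + v‖ ^ (-((n : ℝ) - 1)) + ‖z‖ ^ (-((n : ℝ) - 1))) * |‖z + v‖ - ‖z‖| ≤
    |c| * (‖z + v‖ ^ (-((n : ℝ) - 1)) + ‖z‖ ^ (-((n : ℝ) - 1))) * ‖v‖ := by gcongr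
  have h6 := abs_sub (k ‖z + v‖ - k ‖z‖) (radialGrad c z v)
  linarith

lemma nontrivial_En {n : ℕ} (hn : 1 ≤ n) : Nontrivial (En n) := by
  have : Nonempty (Fin n) := ⟨⟨0, hn⟩⟩
  infer_instance

lemma tendsto_integral_far_remainder {n : ℕ} (hn : 2 ≤ n) {k : ℝ → ℝ} {c b : ℝ}
    (hb : 1 < b) (hkm : Measurable k)
    (hk : ∀ r > 0, HasDerivAt k (c * r ^ (-((n : ℝ) - 1))) r) :
    (∀ v : En n, v ≠ 0 → Integrable ({z : En n | 2 * ‖v‖ ≤ ‖z‖}.indicator fun z =>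
        ‖v‖⁻¹ * |k ‖z + v‖ - k ‖z‖ - radialGrad c z v| * (1 + ‖z‖) ^ (-b))) ∧
    Tendsto (fun v : En n => ∫ z, {z : En n | 2 * ‖v‖ ≤ ‖z‖}.indicator (fun z =>
        ‖v‖⁻¹ * |k ‖z + v‖ - k ‖z‖ - radialGrad c z v| * (1 + ‖z‖) ^ (-b)) z)
      (𝓝[≠] 0) (𝓝 0) := by
  have := nontrivial_En (by omega : 1 ≤ n)
  have hn' : (2 : ℝ) ≤ n := by exact_mod_cast hn
  set D : ℝ := 2 * |c| * (2 ^ ((n : ℝ) - 1) + 1) with hD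
  have hD0 : 0 ≤ D := by positivity
  have hI : Integrable (fun z : En n =>
      D * (‖z‖ ^ (-((n : ℝ) - 1)) * (1 + ‖z‖) ^ (-b))) :=
    (integrable_norm_rpow_mul_one_add_norm_rpow (by omega) (by linarith)
      (by linarith)).const_mul D
  have hm : ∀ v : En n, AEStronglyMeasurable ({z : En n | 2 * ‖v‖ ≤ ‖z‖}.indicator fun z =>
        ‖v‖⁻¹ * |k ‖z + v‖ - k ‖z‖ - radialGrad c z v| * (1 + ‖z‖) ^ (-b)) volume := by
    intro v
    simp only [radialGrad_apply]
    refine (Measurable.indicator ?_ (measurableSet_le (by fun_prop) (by fun_prop))).aestronglyMeasurable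
    have h1 : Measurable fun z : En n => k ‖z + v‖ - k ‖z‖ - c * ‖z‖ ^ (-(n : ℝ)) * ⟪z, v⟫ := by
      fun_prop
    have h2 : Measurable fun z : En n => |k ‖z + v‖ - k ‖z‖ - c * ‖z‖ ^ (-(n : ℝ)) * ⟪z, v⟫| :=
      h1.abs
    fun_prop
  have hbd : ∀ v : En n, v ≠ 0 → ∀ z : En n, ‖{z : En n | 2 * ‖v‖ ≤ ‖z‖}.indicator (fun z =>
        ‖v‖⁻¹ * |k ‖z + v‖ - k ‖z‖ - radialGrad c z v| * (1 + ‖z‖) ^ (-b)) z‖ ≤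
      D * (‖z‖ ^ (-((n : ℝ) - 1)) * (1 + ‖z‖) ^ (-b)) := by
    intro v hv z
    have hv0 : 0 < ‖v‖ := norm_pos_iff.2 hv
    by_cases hz : 2 * ‖v‖ ≤ ‖z‖
    · rw [Set.indicator_of_mem (show z ∈ {z : En n | 2 * ‖v‖ ≤ ‖z‖} from hz), Real.norm_of_nonneg (by positivity), ← mul_assoc]
      refine mul_le_mul_of_nonneg_right ?_ (by positivity)
      have hz0 : 0 < ‖z‖ := by linarith
      have hzv : ‖z‖ / 2 ≤ ‖z + v‖ := by
        have : ‖z‖ ≤ ‖z + v‖ + ‖v‖ := by simpa using norm_sub_le (z + v) v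
        linarith
      have h1 := abs_radial_remainder_le hn hk (norm_pos_iff.1 hz0)
        (norm_pos_iff.1 (by linarith : 0 < ‖z + v‖))
      have h2 : ‖z + v‖ ^ (-((n : ℝ) - 1)) ≤ 2 ^ ((n : ℝ) - 1) * ‖z‖ ^ (-((n : ℝ) - 1)) := by
        refine (Real.rpow_le_rpow_of_nonpos (by positivity) hzv (by linarith)).trans_eq ?_
        rw [Real.div_rpow hz0.le (by norm_num), Real.rpow_neg (by norm_num : (0 : ℝ) ≤ 2),
          div_inv_eq_mul, mul_comm]
      rw [inv_mul_le_iff₀ hv0]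
      refine h1.trans ?_
      calc _ ≤ 2 * |c| * (2 ^ ((n : ℝ) - 1) * ‖z‖ ^ (-((n : ℝ) - 1))
                + ‖z‖ ^ (-((n : ℝ) - 1))) * ‖v‖ := by gcongr
        _ = _ := by rw [hD]; ring
    · rw [Set.indicator_of_notMem (show z ∉ {z : En n | 2 * ‖v‖ ≤ ‖z‖} from hz), norm_zero]; positivity
  refine ⟨fun v hv => hI.mono' (hm v) (ae_of_all _ (hbd v hv)), ?_⟩
  rw [← integral_zero (En n) ℝ]
  refine tendsto_integral_filter_of_dominated_convergence _ (Eventually.of_forall hm)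
    ?_ hI ?_
  · filter_upwards [self_mem_nhdsWithin] with v hv using ae_of_all _ (hbd v hv)
  · have : ∀ᵐ z : En n, z ≠ 0 := compl_mem_ae_iff.2 (measure_singleton 0)
    filter_upwards [this] with z hz
    have h1 := (hasFDerivAt_iff_isLittleO_nhds_zero.1 (hasFDerivAt_radial hk hz)).norm_norm
    have h2 := (h1.tendsto_div_nhds_zero.mono_left
      (nhdsWithin_le_nhds (s := {0}ᶜ))).mul_const ((1 + ‖z‖) ^ (-b))
    rw [zero_mul] at h2
    refine squeeze_zero_norm (fun v => ?_) h2
    rw [norm_indicator_eq_indicator_norm]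
    refine (Set.indicator_le_self' (fun _ _ => norm_nonneg _) z).trans_eq ?_
    rw [Real.norm_of_nonneg (by positivity), Real.norm_eq_abs, inv_mul_eq_div]

/-- The remainders of a radial kernel, divided by the increment, have an integrable majorant whose
integral tends to zero. -/
lemma exists_majorant_radial_remainder {n : ℕ} (hn : 2 ≤ n) {k : ℝ → ℝ} {c b : ℝ}
    (hb : 1 < b) (hkm : Measurable k)
    (hk : ∀ r > 0, HasDerivAt k (c * r ^ (-((n : ℝ) - 1))) r) :
    ∃ g : En n → En n → ℝ, (∀ v, v ≠ 0 → Integrable (g v)) ∧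
      (∀ v, v ≠ 0 → ∀ᵐ z : En n,
        ‖v‖⁻¹ * |k ‖z + v‖ - k ‖z‖ - radialGrad c z v| * (1 + ‖z‖) ^ (-b) ≤ g v z) ∧
      Tendsto (fun v => ∫ z, g v z) (𝓝[≠] 0) (𝓝 0) := by
  have := nontrivial_En (by omega : 1 ≤ n)
  have hn' : (2 : ℝ) ≤ n := by exact_mod_cast hn
  obtain ⟨hfar, hfar0⟩ := tendsto_integral_far_remainder hn hb hkm hk
  obtain ⟨C, hC, H⟩ := exists_integral_norm_rpow_Iic_le (n := n) (by omega)
    (by linarith : (n : ℝ) - 1 < n)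
  set N : En n → En n → ℝ := fun v z =>
    (Set.Iic (3 * ‖v‖)).indicator (fun r : ℝ => r ^ (-((n : ℝ) - 1))) ‖z‖ with hN
  have hNint : ∀ v, v ≠ 0 → Integrable (N v) := fun v hv => (H _ (by positivity)).1
  have hN0 : ∀ v z, 0 ≤ N v z := fun v z => indicator_rpow_nonneg _ _ (norm_nonneg z)
  refine ⟨fun v z => {z : En n | 2 * ‖v‖ ≤ ‖z‖}.indicator (fun z =>
        ‖v‖⁻¹ * |k ‖z + v‖ - k ‖z‖ - radialGrad c z v| * (1 + ‖z‖) ^ (-b)) z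
        + 2 * |c| * (N v (z + v) + N v z), ?_, ?_, ?_⟩
  · intro v hv
    exact (hfar v hv).add
      ((((hNint v hv).comp_add_right v).add (hNint v hv)).const_mul (2 * |c|))
  · intro v hv
    have hv0 : 0 < ‖v‖ := norm_pos_iff.2 hv
    have h1 : ∀ᵐ z : En n, z ≠ 0 := compl_mem_ae_iff.2 (measure_singleton 0)
    have h2 : ∀ᵐ z : En n, z ≠ -v := compl_mem_ae_iff.2 (measure_singleton _)
    filter_upwards [h1, h2] with z hz hzv
    by_cases hzf : 2 * ‖v‖ ≤ ‖z‖
    · rw [Set.indicator_of_mem (show z ∈ {z : En n | 2 * ‖v‖ ≤ ‖z‖} from hzf)]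
      have : 0 ≤ 2 * |c| * (N v (z + v) + N v z) :=
        mul_nonneg (by positivity) (add_nonneg (hN0 _ _) (hN0 _ _))
      linarith
    · rw [Set.indicator_of_notMem (show z ∉ {z : En n | 2 * ‖v‖ ≤ ‖z‖} from hzf), zero_add]
      have hzv' : z + v ≠ 0 := fun h => hzv (eq_neg_of_add_eq_zero_left h)
      have h3 := abs_radial_remainder_le hn hk hz hzv'
      have e1 : N v (z + v) = ‖z + v‖ ^ (-((n : ℝ) - 1)) :=
        Set.indicator_of_mem (Set.mem_Iic.2 (by linarith [norm_add_le z v])) _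
      have e2 : N v z = ‖z‖ ^ (-((n : ℝ) - 1)) :=
        Set.indicator_of_mem (Set.mem_Iic.2 (by linarith)) _
      rw [e1, e2]
      refine (mul_le_of_le_one_right (by positivity)
        (Real.rpow_le_one_of_one_le_of_nonpos (by simp) (by linarith))).trans ?_
      rw [inv_mul_le_iff₀ hv0]
      linarith
  · have hlim : Tendsto (fun v : En n => 2 * |c| * (C * (3 * ‖v‖) + C * (3 * ‖v‖)))
        (𝓝[≠] 0) (𝓝 0) := by
      have : Continuous (fun v : En n => 2 * |c| * (C * (3 * ‖v‖) + C * (3 * ‖v‖))) := by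
        fun_prop
      simpa using (this.tendsto 0).mono_left (nhdsWithin_le_nhds (s := {0}ᶜ))
    have hnear : Tendsto (fun v : En n => ∫ z, 2 * |c| * (N v (z + v) + N v z))
        (𝓝[≠] 0) (𝓝 0) := by
      refine squeeze_zero' (Eventually.of_forall fun v => integral_nonneg fun z =>
        mul_nonneg (by positivity) (add_nonneg (hN0 _ _) (hN0 _ _))) ?_ hlim
      filter_upwards [self_mem_nhdsWithin] with v hv
      have hv' : v ≠ 0 := hv
      rw [integral_const_mul, integral_add ((hNint v hv).comp_add_right v) (hNint v hv),
        integral_add_right_eq_self (N v) v]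
      have h := (H (3 * ‖v‖) (by positivity)).2
      rw [show (n : ℝ) - (n - 1) = 1 by ring, Real.rpow_one] at h
      gcongr
    have := hfar0.add hnear
    rw [add_zero] at this
    refine this.congr' ?_
    filter_upwards [self_mem_nhdsWithin] with v hv
    exact (integral_add (hfar v hv)
      ((((hNint v hv).comp_add_right v).add (hNint v hv)).const_mul (2 * |c|))).symm

/-- Peetre's inequality. -/
lemma one_add_norm_rpow_neg_le {E : Type*} [SeminormedAddCommGroup E] {b : ℝ} (hb : 0 ≤ b)
    (x y : E) :
    (1 + ‖y‖) ^ (-b) ≤ (1 + ‖x‖) ^ b * (1 + ‖x - y‖) ^ (-b) := by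
  have h1 : 1 + ‖x - y‖ ≤ (1 + ‖x‖) * (1 + ‖y‖) := by
    nlinarith [norm_sub_le x y, mul_nonneg (norm_nonneg x) (norm_nonneg y)]
  have h2 : (1 + ‖x - y‖) ^ b ≤ (1 + ‖x‖) ^ b * (1 + ‖y‖) ^ b := by
    rw [← Real.mul_rpow (by positivity) (by positivity)]
    exact Real.rpow_le_rpow (by positivity) h1 hb
  rw [Real.rpow_neg (by positivity), Real.rpow_neg (by positivity), ← div_eq_mul_inv,
    le_div_iff₀ (by positivity), inv_mul_le_iff₀ (by positivity)]
  linarith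

section Potential

variable {n : ℕ} {f : En n → ℝ} {M b : ℝ}

/-- A source dominated by a Japanese bracket can be integrated against a power singularity with
the pole at `x`. -/
lemma integrable_norm_rpow_smul_of_le (hn : 1 ≤ n) (hM : 0 ≤ M) {a : ℝ} (hb : 0 ≤ b)
    (han : a < n) (hab : n < a + b) (hfm : AEStronglyMeasurable f)
    (hf : ∀ y, |f y| ≤ M * (1 + ‖y‖) ^ (-b)) {F : Type*} [NormedAddCommGroup F]
    [NormedSpace ℝ F] {g : En n → F} (hgm : AEStronglyMeasurable g) {D : ℝ}
    (hg : ∀ z, ‖g z‖ ≤ D * ‖z‖ ^ (-a)) (x : En n) :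
    Integrable (fun y => f y • g (x - y)) := by
  have hI := (((integrable_norm_rpow_mul_one_add_norm_rpow hn han hab).const_mul
    (M * (1 + ‖x‖) ^ b * D)).comp_sub_left x)
  refine hI.mono' (hfm.smul (hgm.comp_quasiMeasurePreserving
    (quasiMeasurePreserving_sub_left_of_right_invariant volume x))) (ae_of_all _ fun y => ?_)
  rw [norm_smul, Real.norm_eq_abs]
  calc |f y| * ‖g (x - y)‖
      ≤ (M * ((1 + ‖x‖) ^ b * (1 + ‖x - y‖) ^ (-b))) * (D * ‖x - y‖ ^ (-a)) :=
        mul_le_mul ((hf y).trans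
          (mul_le_mul_of_nonneg_left (one_add_norm_rpow_neg_le hb x y) hM)) (hg _)
          (norm_nonneg _) (by positivity)
    _ = _ := by ring

lemma hasFDerivAt_potential (hn : 2 ≤ n) (hM : 0 ≤ M) (hb : 1 < b) {k : ℝ → ℝ} {c : ℝ}
    (hkm : Measurable k) (hk : ∀ r > 0, HasDerivAt k (c * r ^ (-((n : ℝ) - 1))) r)
    (hfm : AEStronglyMeasurable f) (hf : ∀ y, |f y| ≤ M * (1 + ‖y‖) ^ (-b))
    (hint : ∀ x : En n, Integrable (fun y => k ‖x - y‖ * f y)) (x : En n) :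
    HasFDerivAt (fun x : En n => ∫ y, k ‖x - y‖ * f y)
      (∫ y, f y • radialGrad c (x - y)) x := by
  obtain ⟨g, hg, hle, hlim⟩ := exists_majorant_radial_remainder hn hb hkm hk
  have hG : Integrable (fun y => f y • radialGrad c (x - y)) :=
    integrable_norm_rpow_smul_of_le (by omega) hM (by linarith) (by linarith : (n : ℝ) - 1 < n)
      (by linarith) hfm hf (measurable_radialGrad c).aestronglyMeasurable
      (fun z => (norm_radialGrad hn c z).le) x
  rw [hasFDerivAt_iff_isLittleO_nhds_zero, Asymptotics.isLittleO_iff]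
  intro δ hδ
  set K : ℝ := M * (1 + ‖x‖) ^ b with hK
  have hK0 : 0 ≤ K := by positivity
  have hlim' : Tendsto (fun v => K * ∫ z, g v z) (𝓝[≠] 0) (𝓝 0) := by
    simpa using hlim.const_mul K
  have hev := eventually_nhdsWithin_iff.1 (hlim'.eventually (gt_mem_nhds hδ))
  filter_upwards [hev] with v hv
  rcases eq_or_ne v 0 with rfl | hv0
  · simp
  have hvn : 0 < ‖v‖ := norm_pos_iff.2 hv0
  rw [ContinuousLinearMap.integral_apply hG, ← integral_sub (hint _) (hint _),
    ← integral_sub (by exact (hint (x + v)).sub (hint x)) (hG.apply_continuousLinearMap v)]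
  have hgx : Integrable (fun y => K * ‖v‖ * g v (x - y)) :=
    ((hg v hv0).comp_sub_left x).const_mul _
  refine (norm_integral_le_of_norm_le hgx ?_).trans ?_
  · filter_upwards [(quasiMeasurePreserving_sub_left_of_right_invariant volume x).ae (hle v hv0)]
      with y hy
    have e : k ‖x + v - y‖ * f y - k ‖x - y‖ * f y - (f y • radialGrad c (x - y)) v
        = f y * (k ‖x - y + v‖ - k ‖x - y‖ - radialGrad c (x - y) v) := by
      rw [_root_.smul_apply, smul_eq_mul, show x + v - y = x - y + v by abel]
      ring
    rw [e, norm_mul, Real.norm_eq_abs, Real.norm_eq_abs]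
    have h1 := (hf y).trans
      (mul_le_mul_of_nonneg_left (one_add_norm_rpow_neg_le (by linarith : 0 ≤ b) x y) hM)
    calc _ ≤ (M * ((1 + ‖x‖) ^ b * (1 + ‖x - y‖) ^ (-b))) *
          |k ‖x - y + v‖ - k ‖x - y‖ - radialGrad c (x - y) v| := by gcongr
      _ = K * ‖v‖ * (‖v‖⁻¹ * |k ‖x - y + v‖ - k ‖x - y‖ - radialGrad c (x - y) v| *
          (1 + ‖x - y‖) ^ (-b)) := by rw [hK]; field_simp
      _ ≤ _ := by gcongr
  · rw [integral_const_mul, integral_sub_left_eq_self (g v) volume x]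
    have := (hv hv0).le
    calc K * ‖v‖ * ∫ z, g v z = (K * ∫ z, g v z) * ‖v‖ := by ring
      _ ≤ _ := by gcongr

lemma continuous_integral_smul_radialGrad (hn : 2 ≤ n) (hM : 0 ≤ M) (hb : 1 < b) (c : ℝ)
    (hfm : AEStronglyMeasurable f) (hf : ∀ y, |f y| ≤ M * (1 + ‖y‖) ^ (-b))
    (hfc : ∀ᵐ y, ContinuousAt f y) :
    Continuous (fun x : En n => ∫ y, f y • radialGrad c (x - y)) := by
  have e : (fun x : En n => ∫ y, f y • radialGrad c (x - y))
      = fun x => ∫ z, f (x - z) • radialGrad c z := by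
    funext x
    rw [← integral_sub_left_eq_self (fun z => f (x - z) • radialGrad c z) volume x]
    simp
  rw [e, continuous_iff_continuousAt]
  intro x₀
  have hI := (integrable_norm_rpow_mul_one_add_norm_rpow (n := n) (by omega)
    (by linarith : (n : ℝ) - 1 < n) (by linarith : (n : ℝ) < n - 1 + b)).const_mul
    (M * (1 + (‖x₀‖ + 1)) ^ b * |c|)
  refine continuousAt_of_dominated (Eventually.of_forall fun x => ?_) ?_ hI ?_
  · exact (hfm.comp_quasiMeasurePreserving
      (quasiMeasurePreserving_sub_left_of_right_invariant volume x)).smul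
      (measurable_radialGrad c).aestronglyMeasurable
  · filter_upwards [Metric.ball_mem_nhds x₀ one_pos] with x hx
    refine ae_of_all _ fun z => ?_
    have hx' : ‖x‖ ≤ ‖x₀‖ + 1 := by
      have h1 : ‖x - x₀‖ < 1 := by simpa [dist_eq_norm] using hx
      have h2 : ‖x‖ ≤ ‖x - x₀‖ + ‖x₀‖ := by simpa using norm_add_le (x - x₀) x₀
      linarith
    have h1 := (hf (x - z)).trans
      (mul_le_mul_of_nonneg_left (one_add_norm_rpow_neg_le (by linarith : 0 ≤ b) x (x - z)) hM)
    rw [sub_sub_cancel] at h1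
    rw [norm_smul, Real.norm_eq_abs, norm_radialGrad hn]
    calc _ ≤ (M * ((1 + ‖x‖) ^ b * (1 + ‖z‖) ^ (-b))) *
          (|c| * ‖z‖ ^ (-((n : ℝ) - 1))) := by gcongr
      _ ≤ (M * ((1 + (‖x₀‖ + 1)) ^ b * (1 + ‖z‖) ^ (-b))) *
          (|c| * ‖z‖ ^ (-((n : ℝ) - 1))) := by gcongr
      _ = _ := by ring
  · filter_upwards [(quasiMeasurePreserving_sub_left_of_right_invariant volume x₀).ae hfc]
      with z hz
    have : ContinuousAt (fun x => f (x - z)) x₀ :=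
      ContinuousAt.comp (f := fun x => x - z) hz (by fun_prop)
    exact this.smul continuousAt_const

lemma contDiff_potential (hn : 2 ≤ n) (hM : 0 ≤ M) (hb : 1 < b) {k : ℝ → ℝ} {c : ℝ}
    (hkm : Measurable k) (hk : ∀ r > 0, HasDerivAt k (c * r ^ (-((n : ℝ) - 1))) r)
    (hfm : AEStronglyMeasurable f) (hf : ∀ y, |f y| ≤ M * (1 + ‖y‖) ^ (-b))
    (hfc : ∀ᵐ y, ContinuousAt f y)
    (hint : ∀ x : En n, Integrable (fun y => k ‖x - y‖ * f y)) :
    ContDiff ℝ 1 (fun x : En n => ∫ y, k ‖x - y‖ * f y) :=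
  contDiff_one_iff_hasFDerivAt.2 ⟨_, continuous_integral_smul_radialGrad hn hM hb c hfm hf hfc,
    hasFDerivAt_potential hn hM hb hkm hk hfm hf hint⟩

end Potential

section ExteriorSource

lemma setOf_lt_norm_subset (n : ℕ) (R₁ : ℝ) :
    {y : En n | R₁ < ‖y‖} ⊆ {y : En n | R₁ ≤ ‖y‖} := by
  intro y hy
  simp only [Set.mem_ofPred_eq] at hy ⊢
  exact hy.le

variable {n : ℕ} {R₁ ε C₀ : ℝ} {f₂ : En n → ℝ}

lemma setOf_le_norm_ae_eq (hn : 1 ≤ n) (R₁ : ℝ) :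
    ({y : En n | R₁ ≤ ‖y‖} : Set (En n)) =ᵐ[volume] {y : En n | R₁ < ‖y‖} := by
  have := nontrivial_En hn
  have h : ∀ᵐ y : En n, y ∉ Metric.sphere (0 : En n) R₁ :=
    measure_eq_zero_iff_ae_notMem.1 (Measure.addHaar_sphere volume 0 R₁)
  filter_upwards [h] with y hy
  have hy' : ‖y‖ ≠ R₁ := by simpa using hy
  exact propext ⟨fun h => lt_of_le_of_ne h hy'.symm, fun h => le_of_lt h⟩

lemma mul_indicator_eq (k : En n → ℝ) :
    (fun y => k y * {y : En n | R₁ < ‖y‖}.indicator f₂ y)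
      = {y : En n | R₁ < ‖y‖}.indicator (fun y => k y * f₂ y) := by
  funext y
  by_cases h : y ∈ {y : En n | R₁ < ‖y‖} <;> simp [h]

lemma measurableSet_lt_norm : MeasurableSet {y : En n | R₁ < ‖y‖} :=
  measurableSet_lt measurable_const measurable_norm

lemma setIntegral_mul_eq (hn : 1 ≤ n) (k : En n → ℝ) :
    ∫ y in {y : En n | R₁ ≤ ‖y‖}, k y * f₂ y
      = ∫ y, k y * {y : En n | R₁ < ‖y‖}.indicator f₂ y := by
  rw [setIntegral_congr_set (setOf_le_norm_ae_eq hn R₁), mul_indicator_eq,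
    integral_indicator measurableSet_lt_norm]

lemma integrableOn_mul_iff (hn : 1 ≤ n) (k : En n → ℝ) :
    IntegrableOn (fun y => k y * f₂ y) {y : En n | R₁ ≤ ‖y‖}
      ↔ Integrable (fun y => k y * {y : En n | R₁ < ‖y‖}.indicator f₂ y) := by
  rw [integrableOn_congr_set_ae (setOf_le_norm_ae_eq hn R₁), mul_indicator_eq,
    integrable_indicator_iff measurableSet_lt_norm]

lemma aestronglyMeasurable_indicator_of_continuousOn
    (hc : ContinuousOn f₂ {y : En n | R₁ ≤ ‖y‖}) :
    AEStronglyMeasurable ({y : En n | R₁ < ‖y‖}.indicator f₂) :=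
  (aestronglyMeasurable_indicator_iff measurableSet_lt_norm).2
    ((hc.mono (setOf_lt_norm_subset n R₁)).aestronglyMeasurable measurableSet_lt_norm)

lemma ae_continuousAt_indicator (hn : 1 ≤ n) (hc : ContinuousOn f₂ {y : En n | R₁ ≤ ‖y‖}) :
    ∀ᵐ y, ContinuousAt ({y : En n | R₁ < ‖y‖}.indicator f₂) y := by
  have := nontrivial_En hn
  have h : ∀ᵐ y : En n, y ∉ Metric.sphere (0 : En n) R₁ :=
    measure_eq_zero_iff_ae_notMem.1 (Measure.addHaar_sphere volume 0 R₁)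
  filter_upwards [h] with y hy
  have hy' : ‖y‖ ≠ R₁ := by simpa using hy
  rcases hy'.lt_or_gt with h | h
  · have : {y : En n | R₁ < ‖y‖}.indicator f₂ =ᶠ[𝓝 y] fun _ => 0 := by
      filter_upwards [(isOpen_lt continuous_norm continuous_const).mem_nhds h] with z hz
      exact Set.indicator_of_notMem
        (show z ∉ {y : En n | R₁ < ‖y‖} from fun h' => lt_asymm hz h') _
    exact continuousAt_const.congr this.symm
  · have hnhds := (isOpen_lt continuous_const continuous_norm).mem_nhds h
    have : {y : En n | R₁ < ‖y‖}.indicator f₂ =ᶠ[𝓝 y] f₂ := by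
      filter_upwards [hnhds] with z hz
      exact Set.indicator_of_mem (show z ∈ {y : En n | R₁ < ‖y‖} from hz) _
    exact (hc.continuousAt (mem_of_superset hnhds (setOf_lt_norm_subset n R₁))).congr this.symm

lemma abs_indicator_le_rpow (hC₀ : 0 ≤ C₀)
    (hf : ∀ y : En n, R₁ < ‖y‖ → |f₂ y| ≤ C₀ * ‖y‖ ^ (-2 - 2 * ε)) (y : En n) :
    |{y : En n | R₁ < ‖y‖}.indicator f₂ y| ≤ C₀ * ‖y‖ ^ (-(2 + 2 * ε)) := by
  by_cases h : y ∈ {y : En n | R₁ < ‖y‖}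
  · rw [Set.indicator_of_mem h, neg_add, ← sub_eq_add_neg]
    exact hf y h
  · rw [Set.indicator_of_notMem h, abs_zero]
    positivity

lemma abs_indicator_le_bracket (hR₁ : 0 < R₁) (hε : 0 < ε) (hC₀ : 0 ≤ C₀)
    (hf : ∀ y : En n, R₁ < ‖y‖ → |f₂ y| ≤ C₀ * ‖y‖ ^ (-2 - 2 * ε)) (y : En n) :
    |{y : En n | R₁ < ‖y‖}.indicator f₂ y| ≤
      C₀ * (1 + R₁⁻¹) ^ (2 + 2 * ε) * (1 + ‖y‖) ^ (-(2 + 2 * ε)) := by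
  by_cases h : y ∈ {y : En n | R₁ < ‖y‖}
  · have hy : R₁ < ‖y‖ := h
    have hy0 : 0 < ‖y‖ := hR₁.trans hy
    refine (abs_indicator_le_rpow hC₀ hf y).trans ?_
    rw [mul_assoc]
    refine mul_le_mul_of_nonneg_left ?_ hC₀
    have h1 : 1 + ‖y‖ ≤ (1 + R₁⁻¹) * ‖y‖ := by
      have : 1 ≤ R₁⁻¹ * ‖y‖ := by
        rw [inv_mul_eq_div, one_le_div hR₁]; exact hy.le
      linarith
    have h2 : ((1 + R₁⁻¹) * ‖y‖) ^ (-(2 + 2 * ε)) ≤ (1 + ‖y‖) ^ (-(2 + 2 * ε)) :=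
      Real.rpow_le_rpow_of_nonpos (by positivity) h1 (by linarith)
    rw [Real.mul_rpow (by positivity) hy0.le, Real.rpow_neg (by positivity) (2 + 2 * ε),
      inv_mul_le_iff₀ (by positivity)] at h2
    exact h2
  · rw [Set.indicator_of_notMem h, abs_zero]
    positivity

end ExteriorSource

lemma abs_log_le_rpow_add_rpow {r ε : ℝ} (hr : 0 ≤ r) (hε : 0 < ε) :
    |Real.log r| ≤ ε⁻¹ * (r ^ ε + r ^ (-ε)) := by
  have h1 := Real.log_le_rpow_div hr hε
  have h2 := Real.log_le_rpow_div (inv_nonneg.2 hr) hε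
  rw [Real.log_inv, Real.inv_rpow hr, ← Real.rpow_neg hr] at h2
  have h3 : 0 ≤ r ^ ε / ε := by positivity
  have h4 : 0 ≤ r ^ (-ε) / ε := by positivity
  have e : ε⁻¹ * (r ^ ε + r ^ (-ε)) = r ^ ε / ε + r ^ (-ε) / ε := by ring
  rw [e]
  exact abs_le.2 ⟨by linarith, by linarith⟩

/-- The increment of the logarithm, bounded by a linear weight near the pole and by a small power
elsewhere. -/
lemma abs_log_norm_sub_sub_log_norm_le {E : Type*} [NormedAddCommGroup E] {θ : ℝ} (hθ : 0 < θ)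
    (hθ1 : θ ≤ 1) {x y : E} (hx : x ≠ 0) (hxy : x ≠ y) :
    |Real.log ‖x - y‖ - Real.log ‖x‖| ≤ ‖y‖ * ‖x - y‖⁻¹ + θ⁻¹ * (‖y‖ / ‖x‖) ^ θ := by
  have hx0 : 0 < ‖x‖ := norm_pos_iff.2 hx
  have hxy0 : 0 < ‖x - y‖ := norm_pos_iff.2 (sub_ne_zero.2 hxy)
  have p1 : 0 ≤ ‖y‖ * ‖x - y‖⁻¹ := by positivity
  have p2 : 0 ≤ θ⁻¹ * (‖y‖ / ‖x‖) ^ θ := by positivity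
  rw [← Real.log_div hxy0.ne' hx0.ne', abs_le]
  constructor
  · have h1 : Real.log (‖x‖ / ‖x - y‖) ≤ ‖x‖ / ‖x - y‖ - 1 :=
      Real.log_le_sub_one_of_pos (by positivity)
    have h2 : ‖x‖ / ‖x - y‖ - 1 ≤ ‖y‖ * ‖x - y‖⁻¹ := by
      rw [← div_eq_mul_inv, sub_le_iff_le_add, div_le_iff₀ hxy0, add_mul, div_mul_cancel₀ _ hxy0.ne']
      simpa [add_comm] using norm_add_le (x - y) y
    rw [← inv_div ‖x - y‖ ‖x‖, Real.log_inv, inv_div] at h1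
    linarith
  · have h1 : ‖x - y‖ / ‖x‖ ≤ 1 + ‖y‖ / ‖x‖ := by
      rw [div_le_iff₀ hx0, add_mul, div_mul_cancel₀ _ hx0.ne', one_mul]
      exact norm_sub_le x y
    have h2 : (‖x - y‖ / ‖x‖) ^ θ ≤ 1 + (‖y‖ / ‖x‖) ^ θ := by
      refine (Real.rpow_le_rpow (by positivity) h1 hθ.le).trans ?_
      simpa using Real.rpow_add_le_add_rpow zero_le_one
        (by positivity : 0 ≤ ‖y‖ / ‖x‖) hθ.le hθ1
    have h3 := Real.log_le_sub_one_of_pos (by positivity : 0 < (‖x - y‖ / ‖x‖) ^ θ)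
    rw [Real.log_rpow (by positivity)] at h3
    have h4 : Real.log (‖x - y‖ / ‖x‖) ≤ θ⁻¹ * (‖y‖ / ‖x‖) ^ θ := by
      rw [← div_eq_inv_mul, le_div_iff₀ hθ]
      linarith
    linarith

/-- In the plane, the gradient of the logarithm is an inversion. -/
lemma norm_radialGrad_sub_radialGrad {x y : En 2} (hx : x ≠ 0) (hy : y ≠ 0) :
    ‖radialGrad 1 x - radialGrad 1 y‖ = ‖x - y‖ / (‖x‖ * ‖y‖) := by
  have e : ∀ z : En 2, radialGrad 1 z = innerSL ℝ ((1 / ‖z‖) ^ 2 • z) := by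
    intro z
    rw [radialGrad, map_smul, one_mul, Real.rpow_neg (norm_nonneg z), Real.rpow_natCast, one_div,
      inv_pow]
  rw [e, e, ← map_sub, innerSL_apply_norm, ← dist_eq_norm, dist_div_norm_sq_smul hx hy,
    dist_eq_norm]
  ring

/-- The Newtonian case, with an exact rate. -/
lemma newtonPot_decay {n : ℕ} (hn : 3 ≤ n) {R₁ ε C₀ : ℝ} (hR₁ : 0 < R₁) (hε : 0 < ε)
    (hε' : 2 * ε < 1) (hC₀ : 0 < C₀) :
    ∃ C > (0 : ℝ), ∀ f₂ : En n → ℝ, ContinuousOn f₂ {y : En n | R₁ ≤ ‖y‖} →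
      (∀ y : En n, R₁ < ‖y‖ → |f₂ y| ≤ C₀ * ‖y‖ ^ (-2 - 2 * ε)) →
      (∀ x : En n,
        IntegrableOn (fun y => ‖x - y‖ ^ ((2 : ℝ) - (n : ℝ)) * f₂ y) {y : En n | R₁ ≤ ‖y‖}) ∧
      ContDiff ℝ 1 (newtonPot n R₁ f₂) ∧
      ∀ x : En n, x ≠ 0 →
        |newtonPot n R₁ f₂ x| ≤ C * ‖x‖ ^ (-(2 * ε)) ∧
        ‖fderiv ℝ (newtonPot n R₁ f₂) x‖ ≤ C * ‖x‖ ^ (-(2 * ε) - 1) := by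
  have hn' : (3 : ℝ) ≤ n := by exact_mod_cast hn
  obtain ⟨C₁, hC₁, H₁⟩ := exists_integral_norm_rpow_mul_norm_rpow_le (n := n) (by omega)
    (a := n - 2) (b := 2 + 2 * ε) (by linarith) (by linarith) (by linarith) (by linarith)
    (by linarith)
  obtain ⟨C₂, hC₂, H₂⟩ := exists_integral_norm_rpow_mul_norm_rpow_le (n := n) (by omega)
    (a := n - 1) (b := 2 + 2 * ε) (by linarith) (by linarith) (by linarith) (by linarith)
    (by linarith)
  set A : ℝ := -(1 / ((n : ℝ) * ((n : ℝ) - 2) * (volume (Metric.ball (0 : En n) 1)).toReal))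
    with hA
  set c : ℝ := 2 - n with hc
  refine ⟨|A| * C₀ * C₁ + |A| * C₀ * |c| * C₂ + 1, by positivity, fun f₂ hcont hf₂ => ?_⟩
  set f : En n → ℝ := {y : En n | R₁ < ‖y‖}.indicator f₂ with hf
  have hfm : AEStronglyMeasurable f := aestronglyMeasurable_indicator_of_continuousOn hcont
  have hfb := abs_indicator_le_bracket hR₁ hε hC₀.le hf₂
  have hfr := abs_indicator_le_rpow (ε := ε) hC₀.le hf₂
  have hM : 0 ≤ C₀ * (1 + R₁⁻¹) ^ (2 + 2 * ε) := by positivity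
  have hkm : Measurable (fun r : ℝ => r ^ c) := by fun_prop
  have hk : ∀ r > 0, HasDerivAt (fun r : ℝ => r ^ c) (c * r ^ (-((n : ℝ) - 1))) r := by
    intro r hr
    convert Real.hasDerivAt_rpow_const (p := c) (Or.inl hr.ne') using 3
    rw [hc]; ring
  have hint : ∀ x : En n, Integrable (fun y => ‖x - y‖ ^ c * f y) := by
    intro x
    have := integrable_norm_rpow_smul_of_le (by omega) hM (a := n - 2) (b := 2 + 2 * ε)
      (by linarith) (by linarith) (by linarith) hfm hfb (g := fun z : En n => ‖z‖ ^ c) (D := 1)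
      (Measurable.aestronglyMeasurable (by fun_prop))
      (fun z => by rw [Real.norm_of_nonneg (by positivity), one_mul, hc, neg_sub]) x
    simpa only [smul_eq_mul, mul_comm] using this
  have hpot : newtonPot n R₁ f₂ = fun x => A * ∫ y, ‖x - y‖ ^ c * f y := by
    funext x
    rw [newtonPot, setIntegral_mul_eq (by omega)]
  refine ⟨fun x => (integrableOn_mul_iff (by omega) _).2 (hint x), ?_, fun x hx => ?_⟩
  · rw [hpot]
    exact contDiff_const.mul (contDiff_potential (by omega) hM (by linarith) hkm hk hfm hfb
      (ae_continuousAt_indicator (by omega) hcont) hint)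
  · have hx0 : 0 < ‖x‖ := norm_pos_iff.2 hx
    obtain ⟨I₁, J₁⟩ := H₁ x hx
    obtain ⟨I₂, J₂⟩ := H₂ x hx
    constructor
    · have h1 : ‖∫ y, ‖x - y‖ ^ c * f y‖ ≤ C₀ * (C₁ * ‖x‖ ^ (-(2 * ε))) := by
        refine (norm_integral_le_of_norm_le (I₁.const_mul C₀) (ae_of_all _ fun y => ?_)).trans ?_
        · rw [norm_mul, Real.norm_of_nonneg (by positivity), Real.norm_eq_abs, neg_sub, ← hc]
          calc _ ≤ ‖x - y‖ ^ c * (C₀ * ‖y‖ ^ (-(2 + 2 * ε))) := by gcongr; exact hfr y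
            _ = _ := by ring
        · rw [integral_const_mul]
          rw [show (n : ℝ) - (n - 2) - (2 + 2 * ε) = -(2 * ε) by ring] at J₁
          gcongr
      rw [hpot, abs_mul, ← Real.norm_eq_abs (∫ y, _)]
      have h2 : 0 ≤ (|A| * C₀ * |c| * C₂ + 1) * ‖x‖ ^ (-(2 * ε)) := by positivity
      have h3 := mul_le_mul_of_nonneg_left h1 (abs_nonneg A)
      linarith
    · have hd := (hasFDerivAt_potential (by omega) hM (by linarith) hkm hk hfm hfb hint x).const_mul A
      have h1 : ‖∫ y, f y • radialGrad c (x - y)‖ ≤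
          C₀ * |c| * (C₂ * ‖x‖ ^ (-(2 * ε) - 1)) := by
        refine (norm_integral_le_of_norm_le (I₂.const_mul (C₀ * |c|))
          (ae_of_all _ fun y => ?_)).trans ?_
        · rw [norm_smul, norm_radialGrad (by omega), Real.norm_eq_abs]
          calc _ ≤ (C₀ * ‖y‖ ^ (-(2 + 2 * ε))) * (|c| * ‖x - y‖ ^ (-((n : ℝ) - 1))) := by
                gcongr; exact hfr y
            _ = _ := by ring
        · rw [integral_const_mul]
          rw [show (n : ℝ) - (n - 1) - (2 + 2 * ε) = -(2 * ε) - 1 by ring] at J₂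
          gcongr
      rw [hpot, hd.fderiv, norm_smul, Real.norm_eq_abs]
      have h2 : 0 ≤ (|A| * C₀ * C₁ + 1) * ‖x‖ ^ (-(2 * ε) - 1) := by positivity
      have h3 := mul_le_mul_of_nonneg_left h1 (abs_nonneg A)
      linarith

lemma integrable_log_norm_sub_mul {f : En 2 → ℝ} {M ε : ℝ} (hM : 0 ≤ M) (hε : 0 < ε)
    (hε' : ε < 2) (hfm : AEStronglyMeasurable f)
    (hf : ∀ y, |f y| ≤ M * (1 + ‖y‖) ^ (-(2 + 2 * ε))) (x : En 2) :
    Integrable (fun y => Real.log ‖x - y‖ * f y) := by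
  have key : ∀ a : ℝ, a < 2 → -2 * ε < a →
      Integrable (fun y => f y * ‖x - y‖ ^ (-a)) := fun a ha ha' =>
    integrable_norm_rpow_smul_of_le (n := 2) (by omega) hM (a := a) (b := 2 + 2 * ε)
      (by linarith) (by simpa using ha) (by push_cast; linarith) hfm hf
      (g := fun z : En 2 => ‖z‖ ^ (-a)) (D := 1) (Measurable.aestronglyMeasurable (by fun_prop))
      (fun z => by rw [Real.norm_of_nonneg (by positivity), one_mul]) x
  have hI := (((key (-ε) (by linarith) (by linarith)).norm.add
    (key ε (by linarith) (by linarith)).norm)).const_mul ε⁻¹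
  refine hI.mono' ((Measurable.aestronglyMeasurable (by fun_prop)).mul hfm)
    (ae_of_all _ fun y => ?_)
  have h := abs_log_le_rpow_add_rpow (norm_nonneg (x - y)) hε
  simp only [Pi.add_apply, norm_mul, Real.norm_eq_abs, neg_neg]
  rw [abs_of_nonneg (by positivity : 0 ≤ ‖x - y‖ ^ ε),
    abs_of_nonneg (by positivity : 0 ≤ ‖x - y‖ ^ (-ε))]
  calc _ ≤ ε⁻¹ * (‖x - y‖ ^ ε + ‖x - y‖ ^ (-ε)) * |f y| := by gcongr
    _ = _ := by ring

/-- The planar logarithmic case. -/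
lemma logPot_decay {R₁ ε C₀ εb : ℝ} (hR₁ : 0 < R₁) (hε : 0 < ε)
    (hε' : 2 * ε < 1) (hC₀ : 0 < C₀) (hεb : 0 < εb) (hεb' : εb < 2 * ε) :
    ∃ C > (0 : ℝ), ∀ f₂ : En 2 → ℝ, ContinuousOn f₂ {y : En 2 | R₁ ≤ ‖y‖} →
      (∀ y : En 2, R₁ < ‖y‖ → |f₂ y| ≤ C₀ * ‖y‖ ^ (-2 - 2 * ε)) →
      (∀ x : En 2, IntegrableOn (fun y => (Real.log ‖x - y‖ - Real.log ‖x‖) * f₂ y)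
        {y : En 2 | R₁ ≤ ‖y‖}) ∧
      ContDiffOn ℝ 1 (logPot 2 R₁ f₂) {x : En 2 | 2 * R₁ < ‖x‖} ∧
      ∀ x : En 2, 2 * R₁ < ‖x‖ →
        |logPot 2 R₁ f₂ x| ≤ C * ‖x‖ ^ (-εb) ∧
        ‖fderiv ℝ (logPot 2 R₁ f₂) x‖ ≤ C * ‖x‖ ^ (-εb - 1) := by
  have := nontrivial_En (n := 2) (by omega)
  obtain ⟨C₁, hC₁, H₁⟩ := exists_integral_norm_rpow_mul_norm_rpow_le (n := 2) (by omega)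
    (a := 1) (b := 1 + 2 * ε) (by linarith) (by linarith) (by norm_num)
    (by push_cast; linarith) (by push_cast; linarith)
  obtain ⟨C₂, hC₂, H₂⟩ := exists_integral_norm_rpow_Ioi_le (n := 2) (by omega)
    (a := 2 + 2 * ε - εb) (by push_cast; linarith)
  obtain ⟨I₂, J₂⟩ := H₂ R₁ hR₁
  set A : ℝ := 1 / (2 * Real.pi) with hA
  set Q : ℝ := (2 * R₁) ^ (-(2 * ε - εb)) with hQ
  have hA0 : 0 < A := by positivity
  have hQ0 : 0 < Q := by positivity
  set P : ℝ := R₁ ^ (((2 : ℕ) : ℝ) - (2 + 2 * ε - εb)) with hP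
  have hP0 : 0 < P := by positivity
  have hrate : ∀ x : En 2, 2 * R₁ < ‖x‖ → ‖x‖ ^ (-(2 * ε)) ≤ Q * ‖x‖ ^ (-εb) := by
    intro x hx
    have hx0 : 0 < ‖x‖ := by linarith
    rw [show -(2 * ε) = -(2 * ε - εb) + -εb by ring, Real.rpow_add hx0]
    exact mul_le_mul_of_nonneg_right
      (Real.rpow_le_rpow_of_nonpos (by linarith) hx.le (by linarith)) (by positivity)
  refine ⟨A * C₀ * (C₁ * Q + εb⁻¹ * (C₂ * P)), by positivity, fun f₂ hcont hf₂ => ?_⟩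
  set f : En 2 → ℝ := {y : En 2 | R₁ < ‖y‖}.indicator f₂ with hf
  have hfm : AEStronglyMeasurable f := aestronglyMeasurable_indicator_of_continuousOn hcont
  have hfb := abs_indicator_le_bracket hR₁ hε hC₀.le hf₂
  have hfr := abs_indicator_le_rpow (ε := ε) hC₀.le hf₂
  have hM : 0 ≤ C₀ * (1 + R₁⁻¹) ^ (2 + 2 * ε) := by positivity
  have hk : ∀ r > 0, HasDerivAt Real.log (1 * r ^ (-(((2 : ℕ) : ℝ) - 1))) r := by
    intro r hr
    convert Real.hasDerivAt_log hr.ne' using 1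
    rw [one_mul, ← Real.rpow_neg_one]
    norm_num
  have hint : ∀ x : En 2, Integrable (fun y => Real.log ‖x - y‖ * f y) :=
    integrable_log_norm_sub_mul hM hε (by linarith) hfm hfb
  have hfint : Integrable f := by
    have := integrable_norm_rpow_smul_of_le (n := 2) (by omega) hM (a := 0) (b := 2 + 2 * ε)
      (by linarith) (by norm_num) (by push_cast; linarith) hfm hfb (g := fun _ : En 2 => (1 : ℝ))
      (D := 1) (by fun_prop) (fun z => by simp) 0
    simpa using this
  have hintd : ∀ x : En 2,
      Integrable (fun y => (Real.log ‖x - y‖ - Real.log ‖x‖) * f y) := by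
    intro x
    refine ((hint x).sub (hfint.const_mul (Real.log ‖x‖))).congr (ae_of_all _ fun y => ?_)
    simp only [Pi.sub_apply, sub_mul]
  have hpot' : logPot 2 R₁ f₂ =
      fun x => A * ∫ y, (Real.log ‖x - y‖ - Real.log ‖x‖) * f y := by
    funext x
    rw [logPot, setIntegral_mul_eq (by omega)]
  have hpot : logPot 2 R₁ f₂ =
      fun x => A * ((∫ y, Real.log ‖x - y‖ * f y) - Real.log ‖x‖ * ∫ y, f y) := by
    rw [hpot']
    funext x
    simp only [sub_mul]
    rw [integral_sub (hint x) (hfint.const_mul _), integral_const_mul]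
  refine ⟨fun x => (integrableOn_mul_iff (by omega) _).2 (hintd x), ?_, fun x hx => ?_⟩
  · rw [hpot]
    refine contDiffOn_const.mul (ContDiffOn.sub (contDiff_potential le_rfl hM (by linarith)
      Real.measurable_log hk hfm hfb (ae_continuousAt_indicator (by omega) hcont)
      hint).contDiffOn (ContDiffOn.mul ?_ contDiffOn_const))
    intro x hx
    have hx' : 2 * R₁ < ‖x‖ := hx
    have hx0 : 0 < ‖x‖ := by linarith
    exact ((contDiffAt_norm ℝ (norm_pos_iff.1 hx0)).log hx0.ne').contDiffWithinAt
  · have hx0 : 0 < ‖x‖ := by linarith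
    have hxne : x ≠ 0 := norm_pos_iff.1 hx0
    obtain ⟨I₁, J₁⟩ := H₁ x hxne
    rw [show ((2 : ℕ) : ℝ) - 1 - (1 + 2 * ε) = -(2 * ε) by push_cast; ring] at J₁
    have hne : ∀ᵐ y : En 2, y ≠ x := compl_mem_ae_iff.2 (measure_singleton x)
    have hJ := hrate x hx
    have hyf : ∀ y, ‖y‖ * |f y| ≤ C₀ * ‖y‖ ^ (-(1 + 2 * ε)) := by
      intro y
      rcases eq_or_ne y 0 with rfl | hy
      · rw [norm_zero, zero_mul]; positivity
      · have hy0 : 0 < ‖y‖ := norm_pos_iff.2 hy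
        refine (mul_le_mul_of_nonneg_left (hfr y) hy0.le).trans_eq ?_
        rw [show -(1 + 2 * ε) = -(2 + 2 * ε) + 1 by ring, Real.rpow_add_one hy0.ne']
        ring
    constructor
    · have hθf : ∀ y, (‖y‖ / ‖x‖) ^ εb * |f y| ≤ C₀ * ‖x‖ ^ (-εb) *
          (Set.Ioi R₁).indicator (fun r : ℝ => r ^ (-(2 + 2 * ε - εb))) ‖y‖ := by
        intro y
        by_cases hy : R₁ < ‖y‖
        · rw [Set.indicator_of_mem (Set.mem_Ioi.2 hy)]
          have hy0 : 0 < ‖y‖ := hR₁.trans hy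
          refine (mul_le_mul_of_nonneg_left (hfr y) (by positivity)).trans_eq ?_
          rw [show -(2 + 2 * ε - εb) = εb + -(2 + 2 * ε) by ring, Real.rpow_add hy0,
            Real.div_rpow hy0.le hx0.le, Real.rpow_neg hx0.le]
          ring
        · have : f y = 0 :=
            Set.indicator_of_notMem (show y ∉ {y : En 2 | R₁ < ‖y‖} from hy) _
          rw [this, abs_zero, mul_zero]
          exact mul_nonneg (by positivity) (indicator_rpow_nonneg _ _ (norm_nonneg y))
      have h1 : ‖∫ y, (Real.log ‖x - y‖ - Real.log ‖x‖) * f y‖ ≤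
          C₀ * (C₁ * ‖x‖ ^ (-(2 * ε))) + εb⁻¹ * (C₀ * ‖x‖ ^ (-εb) * (C₂ * P)) := by
        refine (norm_integral_le_of_norm_le ((I₁.const_mul C₀).add
          ((I₂.const_mul (C₀ * ‖x‖ ^ (-εb))).const_mul εb⁻¹)) ?_).trans ?_
        · filter_upwards [hne] with y hy
          rw [norm_mul, Real.norm_eq_abs, Real.norm_eq_abs, Pi.add_apply, Real.rpow_neg_one]
          have hlog := abs_log_norm_sub_sub_log_norm_le hεb (by linarith) hxne hy.symm
          have k1 := mul_le_mul_of_nonneg_right hlog (abs_nonneg (f y))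
          have k2 := mul_le_mul_of_nonneg_left (hyf y) (by positivity : 0 ≤ ‖x - y‖⁻¹)
          have k3 := mul_le_mul_of_nonneg_left (hθf y) (by positivity : 0 ≤ εb⁻¹)
          linarith
        · simp only [Pi.add_apply]
          rw [integral_add (I₁.const_mul C₀)
            ((I₂.const_mul (C₀ * ‖x‖ ^ (-εb))).const_mul εb⁻¹), integral_const_mul,
            integral_const_mul, integral_const_mul]
          gcongr
      rw [hpot', abs_mul, abs_of_pos hA0, ← Real.norm_eq_abs (∫ y, _)]
      calc _ ≤ A * (C₀ * (C₁ * (Q * ‖x‖ ^ (-εb)))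
            + εb⁻¹ * (C₀ * ‖x‖ ^ (-εb) * (C₂ * P))) := by
              refine mul_le_mul_of_nonneg_left (h1.trans ?_) hA0.le
              gcongr
        _ = _ := by ring
    · have hG : Integrable (fun y => f y • radialGrad 1 (x - y)) :=
        integrable_norm_rpow_smul_of_le (a := ((2 : ℕ) : ℝ) - 1) (b := 2 + 2 * ε) (by omega) hM
          (by linarith) (by linarith) (by push_cast; linarith) hfm hfb
          (measurable_radialGrad 1).aestronglyMeasurable
          (fun z => (norm_radialGrad le_rfl 1 z).le) x
      have hd : HasFDerivAt
          (fun x => A * ((∫ y, Real.log ‖x - y‖ * f y) - Real.log ‖x‖ * ∫ y, f y))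
          (A • ((∫ y, f y • radialGrad 1 (x - y)) - (∫ y, f y) • radialGrad 1 x)) x :=
        ((hasFDerivAt_potential le_rfl hM (by linarith) Real.measurable_log hk hfm hfb
        hint x).sub ((hasFDerivAt_radial hk hxne).mul_const (∫ y, f y))).const_mul A
      have e : (∫ y, f y • radialGrad 1 (x - y)) - (∫ y, f y) • radialGrad 1 x
          = ∫ y, f y • (radialGrad 1 (x - y) - radialGrad 1 x) := by
        simp only [smul_sub]
        rw [integral_sub hG (hfint.smul_const _), integral_smul_const]
      have h1 : ‖∫ y, f y • (radialGrad 1 (x - y) - radialGrad 1 x)‖ ≤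
          C₀ * ‖x‖⁻¹ * (C₁ * ‖x‖ ^ (-(2 * ε))) := by
        refine (norm_integral_le_of_norm_le (I₁.const_mul (C₀ * ‖x‖⁻¹)) ?_).trans ?_
        · filter_upwards [hne] with y hy
          rw [norm_smul, norm_radialGrad_sub_radialGrad (sub_ne_zero.2 hy.symm) hxne,
            sub_sub_cancel_left, norm_neg, Real.norm_eq_abs, Real.rpow_neg_one]
          calc _ = ‖x‖⁻¹ * ‖x - y‖⁻¹ * (‖y‖ * |f y|) := by
                rw [div_eq_mul_inv, mul_inv]; ring
            _ ≤ ‖x‖⁻¹ * ‖x - y‖⁻¹ * (C₀ * ‖y‖ ^ (-(1 + 2 * ε))) :=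
                mul_le_mul_of_nonneg_left (hyf y) (by positivity)
            _ = _ := by ring
        · rw [integral_const_mul]
          gcongr
      rw [hpot, hd.fderiv, norm_smul, Real.norm_of_nonneg hA0.le, e,
        Real.rpow_sub_one hx0.ne', div_eq_mul_inv]
      have h2 : 0 ≤ A * C₀ * (εb⁻¹ * (C₂ * P)) * (‖x‖ ^ (-εb) * ‖x‖⁻¹) := by positivity
      have h3 : A * ‖∫ y, f y • (radialGrad 1 (x - y) - radialGrad 1 x)‖ ≤
          A * (C₀ * ‖x‖⁻¹ * (C₁ * (Q * ‖x‖ ^ (-εb)))) := by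
        refine mul_le_mul_of_nonneg_left (h1.trans ?_) hA0.le
        gcongr
      linarith

/-- Equation (12feb27e5): decay of the Newtonian (resp. logarithmic) potential of a source decaying
like `|y|^{-2-2ε}`, with constants depending only on `(n, R₁, ε, C₀)`. -/
theorem potential_decay
    (n : ℕ) (hn : 2 ≤ n) (R₁ ε C₀ : ℝ)
    (hR₁ : 0 < R₁) (hε : 0 < ε) (hε' : 2 * ε < 1) (hC₀ : 0 < C₀) :
    (3 ≤ n → ∃ C > (0 : ℝ), ∀ f₂ : En n → ℝ,
      ContinuousOn f₂ {y : En n | R₁ ≤ ‖y‖} →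
      (∀ y : En n, R₁ < ‖y‖ → |f₂ y| ≤ C₀ * ‖y‖ ^ (-2 - 2 * ε)) →
      (∀ x : En n,
        IntegrableOn (fun y => ‖x - y‖ ^ ((2 : ℝ) - (n : ℝ)) * f₂ y) {y : En n | R₁ ≤ ‖y‖}) ∧
      ContDiffOn ℝ 1 (newtonPot n R₁ f₂) {x : En n | 2 * R₁ < ‖x‖} ∧
      (∀ x : En n, 2 * R₁ < ‖x‖ →
        |newtonPot n R₁ f₂ x| ≤ C * ‖x‖ ^ (-(2 * ε)) ∧
        ‖fderiv ℝ (newtonPot n R₁ f₂) x‖ ≤ C * ‖x‖ ^ (-(2 * ε) - 1))) ∧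
    (n = 2 → ∀ εb : ℝ, 0 < εb → εb < 2 * ε → ∃ C > (0 : ℝ), ∀ f₂ : En n → ℝ,
      ContinuousOn f₂ {y : En n | R₁ ≤ ‖y‖} →
      (∀ y : En n, R₁ < ‖y‖ → |f₂ y| ≤ C₀ * ‖y‖ ^ (-2 - 2 * ε)) →
      (∀ x : En n,
        IntegrableOn (fun y => (Real.log ‖x - y‖ - Real.log ‖x‖) * f₂ y) {y : En n | R₁ ≤ ‖y‖}) ∧
      ContDiffOn ℝ 1 (logPot n R₁ f₂) {x : En n | 2 * R₁ < ‖x‖} ∧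
      (∀ x : En n, 2 * R₁ < ‖x‖ →
        |logPot n R₁ f₂ x| ≤ C * ‖x‖ ^ (-εb) ∧
        ‖fderiv ℝ (logPot n R₁ f₂) x‖ ≤ C * ‖x‖ ^ (-εb - 1))) := by
  refine ⟨fun hn₃ => ?_, fun hn₂ εb hεb hεb' => ?_⟩
  · obtain ⟨C, hC, H⟩ := newtonPot_decay hn₃ hR₁ hε hε' hC₀
    refine ⟨C, hC, fun f₂ hcont hf₂ => ?_⟩
    obtain ⟨h1, h2, h3⟩ := H f₂ hcont hf₂
    exact ⟨h1, h2.contDiffOn, fun x hx => h3 x (norm_pos_iff.1 (by linarith))⟩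
  · subst hn₂
    exact logPot_decay hR₁ hε hε' hC₀ hεb hεb'
end
end
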